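/- arXiv:1212.1698 — 4 statements merged into one kernel-verified Lean document; each statement's English description precedes it below -/
import Mathlib

section
/- For every integer n ≥ 1, the n-th symmetric product ℝ^(n) admits a bi-Lipschitz embedding into the Euclidean space ℝ^m, where m = 2·⌊(e−1)·n!⌋. That is, there exist a constant L ≥ 1 and a map f : ℝ^(n) → ℝ^m such that L⁻¹·d_H(A,B) ≤ ‖f(A) − f(B)‖ ≤ L·d_H(A,B) for all A, B ∈ ℝ^(n). -/
open Metric

namespace SymProd

def near (δ : ℝ) (A B : Set ℝ) : Prop :=
  (∀ x ∈ A, ∃ y ∈ B, |x - y| ≤ δ) ∧ (∀ y ∈ B, ∃ x ∈ A, |x - y| ≤ δ)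

lemma near.symm {δ : ℝ} {A B : Set ℝ} (h : near δ A B) : near δ B A := by
  refine ⟨fun x hx => ?_, fun x hx => ?_⟩
  · obtain ⟨y, hy, h1⟩ := h.2 x hx
    exact ⟨y, hy, by rwa [abs_sub_comm]⟩
  · obtain ⟨y, hy, h1⟩ := h.1 x hx
    exact ⟨y, hy, by rwa [abs_sub_comm]⟩

def ZZ (n : ℕ) (A : Set ℝ) : Prop :=
  A.Finite ∧ 0 ∈ A ∧ (∀ x ∈ A, 0 ≤ x) ∧ A.ncard ≤ n

noncomputable def hh (l r x : ℝ) : ℝ := min x (max l (x - r + l))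

structure Spl (A : Set ℝ) (t D l r : ℝ) : Prop where
  zero : (0:ℝ) ∈ A
  top : D ∈ A
  nn : ∀ x ∈ A, 0 ≤ x
  le : ∀ x ∈ A, x ≤ D
  lmem : l ∈ A
  rmem : r ∈ A
  lc : l ≤ t * D
  cr : t * D ≤ r
  gap : ∀ x ∈ A, x ≤ l ∨ r ≤ x

noncomputable def gg (t D l r : ℝ) : ℝ := min (t * D - l) (r - t * D)

noncomputable def lf (t : ℝ) (A : Set ℝ) : ℝ := sSup (A ∩ Set.Iic (t * sSup A))
noncomputable def rf (t : ℝ) (A : Set ℝ) : ℝ := sInf (A ∩ Set.Ici (t * sSup A))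

lemma spl_exists {n : ℕ} {A : Set ℝ} (hA : ZZ n A) {t : ℝ} (h0 : 0 ≤ t) (h1 : t ≤ 1) :
    Spl A t (sSup A) (lf t A) (rf t A) := by
  obtain ⟨hf, hz, hn, -⟩ := hA
  have hD : sSup A ∈ A := Set.Nonempty.csSup_mem ⟨0, hz⟩ hf
  have hle : ∀ x ∈ A, x ≤ sSup A := fun x hx => le_csSup hf.bddAbove hx
  have hD0 := hn _ hD
  have f1 : (A ∩ Set.Iic (t * sSup A)).Finite := hf.subset Set.inter_subset_left
  have f2 : (A ∩ Set.Ici (t * sSup A)).Finite := hf.subset Set.inter_subset_left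
  have n1 : (A ∩ Set.Iic (t * sSup A)).Nonempty := ⟨0, hz, mul_nonneg h0 hD0⟩
  have n2 : (A ∩ Set.Ici (t * sSup A)).Nonempty := ⟨sSup A, hD, mul_le_of_le_one_left hD0 h1⟩
  have m1 := n1.csSup_mem f1
  have m2 := n2.csInf_mem f2
  refine ⟨hz, hD, hn, hle, m1.1, m2.1, m1.2, m2.2, fun x hx => ?_⟩
  rcases le_total x (t * sSup A) with h | h
  · exact Or.inl (le_csSup f1.bddAbove ⟨hx, h⟩)
  · exact Or.inr (csInf_le f2.bddBelow ⟨hx, h⟩)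

lemma Spl.g_nonneg {A : Set ℝ} {t D l r : ℝ} (h : Spl A t D l r) : 0 ≤ gg t D l r :=
  le_min (by linarith [h.lc]) (by linarith [h.cr])

lemma Spl.g_le {A : Set ℝ} {t D l r : ℝ} (h : Spl A t D l r) : gg t D l r ≤ D := by
  have h1 := h.lc
  have h2 := h.cr
  have h3 := h.le _ h.rmem
  have h4 := h.nn _ h.lmem
  exact (min_le_left _ _).trans (by linarith)

lemma Spl.g_le_abs {A : Set ℝ} {t D l r : ℝ} (h : Spl A t D l r) {x : ℝ} (hx : x ∈ A) :
    gg t D l r ≤ |t * D - x| := by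
  rcases h.gap x hx with h1 | h1
  · exact (min_le_left _ _).trans (le_trans (by linarith) (le_abs_self _))
  · exact (min_le_right _ _).trans (le_trans (by linarith) (neg_le_abs _))

lemma Spl.g_ex {A : Set ℝ} {t D l r : ℝ} (h : Spl A t D l r) :
    ∃ x ∈ A, gg t D l r = |t * D - x| := by
  rcases min_choice (t * D - l) (r - t * D) with h1 | h1
  · exact ⟨l, h.lmem, by rw [gg, h1, abs_of_nonneg]; linarith [h.lc]⟩
  · exact ⟨r, h.rmem, by rw [gg, h1, abs_sub_comm, abs_of_nonneg]; linarith [h.cr]⟩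

lemma Spl.zz {A : Set ℝ} {n : ℕ} {t D l r : ℝ} (h : Spl A t D l r) (hA : ZZ (n+1) A)
    (hg : 0 < gg t D l r) : ZZ n (hh l r '' A) := by
  obtain ⟨hf, hz, hn, hc⟩ := hA
  have a1 : 0 < t * D - l := lt_of_lt_of_le hg (min_le_left _ _)
  have a2 : 0 < r - t * D := lt_of_lt_of_le hg (min_le_right _ _)
  have hl := hn _ h.lmem
  have hr := hn _ h.rmem
  refine ⟨hf.image _, ⟨0, hz, ?_⟩, ?_, ?_⟩
  · simp [hh, hl]
  · rintro _ ⟨x, hx, rfl⟩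
    exact le_min (hn x hx) (le_max_of_le_left hl)
  · have e : hh l r '' A ⊆ hh l r '' (A \ {r}) := by
      rintro _ ⟨x, hx, rfl⟩
      by_cases hxr : x = r
      · refine ⟨l, ⟨h.lmem, ?_⟩, ?_⟩
        · simp; linarith
        · subst hxr
          have e1 : l - x + l ≤ l := by linarith
          have e2 : l ≤ x := by linarith
          simp [hh, e1, e2]
      · exact ⟨x, ⟨hx, hxr⟩, rfl⟩
    have hf' : (A \ {r}).Finite := hf.subset Set.sdiff_subset
    have := (Set.ncard_le_ncard e (hf'.image _)).trans (Set.ncard_image_le hf')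
    rw [Set.ncard_sdiff_singleton_of_mem h.rmem] at this
    omega

lemma D_lip {A B : Set ℝ} {t D l r t' D' l' r' δ : ℝ} (h : Spl A t D l r) (h' : Spl B t' D' l' r')
    (hn : near δ A B) : |D - D'| ≤ δ := by
  obtain ⟨y, hy, h1⟩ := hn.1 _ h.top
  obtain ⟨x, hx, h2⟩ := hn.2 _ h'.top
  have := h.le _ hx
  have := h'.le _ hy
  rw [abs_le] at *
  constructor <;> linarith

lemma g_lip1 {A B : Set ℝ} {t D l r D' l' r' δ : ℝ} (h : Spl A t D l r) (h' : Spl B t D' l' r')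
    (h0 : 0 ≤ t) (h1 : t ≤ 1)
    (hn : near δ A B) : gg t D l r ≤ gg t D' l' r' + 2 * δ := by
  obtain ⟨y, hy, e⟩ := h'.g_ex
  obtain ⟨x, hx, h2⟩ := hn.2 _ hy
  have h3 := h.g_le_abs hx
  have h4 := D_lip h h' hn
  have h5 : |t * (D - D')| ≤ δ := by
    rw [abs_mul, abs_of_nonneg h0]
    exact (mul_le_of_le_one_left (abs_nonneg _) h1).trans h4
  have h6 : t * D - x = t * (D - D') + (t * D' - y) - (x - y) := by ring
  have h7 := abs_sub (t * (D - D') + (t * D' - y)) (x - y)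
  have h8 := abs_add_le (t * (D - D')) (t * D' - y)
  rw [h6] at h3
  linarith

lemma g_lip {A B : Set ℝ} {t D l r D' l' r' δ : ℝ} (h : Spl A t D l r) (h' : Spl B t D' l' r')
    (h0 : 0 ≤ t) (h1 : t ≤ 1)
    (hn : near δ A B) : |gg t D l r - gg t D' l' r'| ≤ 2 * δ := by
  have := g_lip1 h h' h0 h1 hn
  have := g_lip1 h' h h0 h1 hn.symm
  rw [abs_le]; constructor <;> linarith

lemma lr_lip {A B : Set ℝ} {t D l r D' l' r' δ : ℝ} (h : Spl A t D l r) (h' : Spl B t D' l' r')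
    (h0 : 0 ≤ t) (h1 : t ≤ 1) (hd : 0 ≤ δ)
    (hn : near δ A B) (hg : 4 * δ < gg t D l r) : |l - l'| ≤ δ ∧ |r - r'| ≤ δ := by
  have hg' := g_lip1 h h' h0 h1 hn
  have h4 := D_lip h h' hn
  have h5 : |t * (D - D')| ≤ δ := by
    rw [abs_mul, abs_of_nonneg h0]
    exact (mul_le_of_le_one_left (abs_nonneg _) h1).trans h4
  have g1 : gg t D l r ≤ t * D - l := min_le_left _ _
  have g2 : gg t D l r ≤ r - t * D := min_le_right _ _
  have g3 : gg t D' l' r' ≤ t * D' - l' := min_le_left _ _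
  have g4 : gg t D' l' r' ≤ r' - t * D' := min_le_right _ _
  obtain ⟨y, hy, i1⟩ := hn.1 _ h.lmem
  obtain ⟨y2, hy2, i2⟩ := hn.1 _ h.rmem
  obtain ⟨x, hx, i3⟩ := hn.2 _ h'.lmem
  obtain ⟨x2, hx2, i4⟩ := hn.2 _ h'.rmem
  have j1 := h'.gap _ hy
  have j2 := h'.gap _ hy2
  have j3 := h.gap _ hx
  have j4 := h.gap _ hx2
  have := h.lc
  have := h.cr
  have := h'.lc
  have := h'.cr
  rw [mul_sub] at h5
  simp only [abs_le] at *
  have k1 : y ≤ l' := by rcases j1 with j | j <;> linarith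
  have k2 : r' ≤ y2 := by rcases j2 with j | j <;> linarith
  have k3 : x ≤ l := by rcases j3 with j | j <;> linarith
  have k4 : r ≤ x2 := by rcases j4 with j | j <;> linarith
  refine ⟨⟨?_, ?_⟩, ?_, ?_⟩ <;> linarith

lemma hh_lip {l r x l' r' x' δ : ℝ} (hl : |l - l'| ≤ δ) (hr : |r - r'| ≤ δ) (hx : |x - x'| ≤ δ) :
    |hh l r x - hh l' r' x'| ≤ 3 * δ := by
  have hd : 0 ≤ δ := (abs_nonneg _).trans hl
  unfold hh
  refine (abs_min_sub_min_le_max _ _ _ _).trans (max_le (by linarith) ?_)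
  refine (abs_max_sub_max_le_max _ _ _ _).trans (max_le (by linarith) ?_)
  rw [abs_le] at *
  constructor <;> linarith

lemma near_image {A B : Set ℝ} {l r l' r' δ : ℝ} (hn : near δ A B) (hl : |l - l'| ≤ δ)
    (hr : |r - r'| ≤ δ) : near (3 * δ) (hh l r '' A) (hh l' r' '' B) := by
  constructor
  · rintro _ ⟨x, hx, rfl⟩
    obtain ⟨y, hy, h⟩ := hn.1 x hx
    exact ⟨_, ⟨y, hy, rfl⟩, hh_lip hl hr h⟩
  · rintro _ ⟨y, hy, rfl⟩
    obtain ⟨x, hx, h⟩ := hn.2 y hy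
    exact ⟨_, ⟨x, hx, rfl⟩, hh_lip hl hr h⟩

lemma hh_left {l r x : ℝ} (h : x ≤ l) : hh l r x = x := by
  simp [hh, h]

lemma hh_right {l r x : ℝ} (hlr : l ≤ r) (h : r ≤ x) : hh l r x = x - r + l := by
  have : l ≤ x - r + l := by linarith
  rw [hh, max_eq_right this, min_eq_right]; linarith

lemma near_back1 {A B : Set ℝ} {t D l r t' D' l' r' δ : ℝ} (h : Spl A t D l r)
    (h' : Spl B t' D' l' r')
    (hn : near δ (hh l r '' A) (hh l' r' '' B)) (hl : |l - l'| ≤ δ) (hr : |r - r'| ≤ δ) :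
    ∀ x ∈ A, ∃ y ∈ B, |x - y| ≤ 3 * δ := by
  intro x hx
  obtain ⟨_, ⟨y, hy, rfl⟩, e⟩ := hn.1 _ ⟨x, hx, rfl⟩
  have q := h.lc.trans h.cr
  have q' := h'.lc.trans h'.cr
  have hd : 0 ≤ δ := (abs_nonneg _).trans hl
  rcases h.gap x hx with h1 | h1 <;> rcases h'.gap y hy with h2 | h2
  · rw [hh_left h1, hh_left h2] at e
    exact ⟨y, hy, by linarith⟩
  · rw [hh_left h1, hh_right q' h2] at e
    refine ⟨l', h'.lmem, ?_⟩
    rw [abs_le] at *; constructor <;> linarith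
  · rw [hh_right q h1, hh_left h2] at e
    refine ⟨r', h'.rmem, ?_⟩
    rw [abs_le] at *; constructor <;> linarith
  · rw [hh_right q h1, hh_right q' h2] at e
    refine ⟨y, hy, ?_⟩
    rw [abs_le] at *; constructor <;> linarith

lemma near_back {A B : Set ℝ} {t D l r t' D' l' r' δ : ℝ} (h : Spl A t D l r)
    (h' : Spl B t' D' l' r')
    (hn : near δ (hh l r '' A) (hh l' r' '' B)) (hl : |l - l'| ≤ δ) (hr : |r - r'| ≤ δ) :
    near (3 * δ) A B := by
  refine ⟨near_back1 h h' hn hl hr, fun y hy => ?_⟩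
  rw [abs_sub_comm] at hl hr
  obtain ⟨x, hx, e⟩ := near_back1 h' h hn.symm hl hr y hy
  exact ⟨x, hx, by rwa [abs_sub_comm]⟩

lemma prod_bound {g D v C : ℝ} (h0 : 0 ≤ g) (h1 : g ≤ D) (hC : 0 ≤ C) (hv : 0 < g → |v| ≤ C * D) :
    |g / D * v| ≤ C * g := by
  rcases h0.eq_or_lt with h | h
  · simp [← h]
  · have hD : 0 < D := h.trans_le h1
    rw [abs_mul, abs_of_nonneg (by positivity)]
    calc g / D * |v| ≤ g / D * (C * D) := by gcongr; exact hv h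
      _ = C * g := by field_simp

/-- ratio estimate -/
lemma ratio_est {g D g' D' v' C ε η : ℝ} (h0 : 0 ≤ g) (h1 : g ≤ D) (hD : 0 < D)
    (h0' : 0 ≤ g') (h1' : g' ≤ D')
    (hC : 0 ≤ C) (hv' : |v'| ≤ C * D') (hg : |g - g'| ≤ ε) (hDD : |D - D'| ≤ η) :
    |(g / D - g' / D') * v'| ≤ C * (ε + η) := by
  have hD' : 0 ≤ D' := h0'.trans h1'
  have e : (g / D - g' / D') * D' = (g - g') - g / D * (D - D') := by
    rcases hD'.eq_or_lt with h | h
    · have : g' = 0 := by linarith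
      subst this; rw [← h]; field_simp; ring
    · field_simp; ring
  have q0 : 0 ≤ g / D := by positivity
  have q1 : g / D ≤ 1 := (div_le_one hD).2 h1
  have e2 : |(g / D - g' / D') * D'| ≤ ε + η := by
    rw [e]
    refine (abs_sub _ _).trans ?_
    rw [abs_mul, abs_of_nonneg q0]
    have := mul_le_of_le_one_left (abs_nonneg (D - D')) q1
    linarith
  rw [abs_mul, abs_of_nonneg hD'] at e2
  rw [abs_mul]
  calc _ ≤ |g / D - g' / D'| * (C * D') := by gcongr
    _ = C * (|g / D - g' / D'| * D') := by ring
    _ ≤ _ := by gcongr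

lemma prod_lip1 {g D v g' D' v' C K δ : ℝ} (h0 : 0 ≤ g) (h1 : g ≤ D) (hg0 : 0 < g)
    (h0' : 0 ≤ g') (h1' : g' ≤ D')
    (hC : 0 ≤ C) (hv' : |v'| ≤ C * D') (hg : |g - g'| ≤ 2 * δ) (hDD : |D - D'| ≤ δ)
    (hvv : |v - v'| ≤ K * δ) :
    |g / D * v - g' / D' * v'| ≤ (3 * C + K) * δ := by
  have hD : 0 < D := hg0.trans_le h1
  have := ratio_est h0 h1 hD h0' h1' hC hv' hg hDD
  have e : g / D * v - g' / D' * v' = g / D * (v - v') + (g / D - g' / D') * v' := by ring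
  have q0 : 0 ≤ g / D := by positivity
  have q1 : g / D ≤ 1 := (div_le_one hD).2 h1
  rw [e]
  refine (abs_add_le _ _).trans ?_
  rw [abs_mul (g / D), abs_of_nonneg q0]
  have := mul_le_of_le_one_left (abs_nonneg (v - v')) q1
  nlinarith

lemma prod_lip {g D v g' D' v' C K δ : ℝ} (h0 : 0 ≤ g) (h1 : g ≤ D)
    (h0' : 0 ≤ g') (h1' : g' ≤ D') (hd : 0 ≤ δ) (hK : 0 ≤ K)
    (hC : 0 ≤ C) (hv : 0 < g → |v| ≤ C * D) (hv' : 0 < g' → |v'| ≤ C * D')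
    (hg : |g - g'| ≤ 2 * δ) (hDD : |D - D'| ≤ δ)
    (hvv : 4 * δ < g ∨ 4 * δ < g' → 0 < g → 0 < g' → |v - v'| ≤ K * δ) :
    |g / D * v - g' / D' * v'| ≤ (8 * C + K) * δ := by
  have hCd := mul_nonneg hC hd
  have hKd := mul_nonneg hK hd
  by_cases hc : 4 * δ < g ∨ 4 * δ < g'
  · have hg1 := abs_le.1 hg
    have p : 0 < g := by rcases hc with h | h <;> linarith
    have p' : 0 < g' := by rcases hc with h | h <;> linarith
    have := prod_lip1 h0 h1 p h0' h1' hC (hv' p') hg hDD (hvv hc p p')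
    nlinarith
  · push Not at hc
    have a1 := prod_bound h0 h1 hC hv
    have a2 := prod_bound h0' h1' hC hv'
    have := abs_sub (g / D * v) (g' / D' * v')
    nlinarith

lemma prod_rec {g D v g' D' v' C κ ε : ℝ} (h0 : 0 ≤ g) (h1 : g ≤ D) (hD : 0 < D)
    (h0' : 0 ≤ g') (h1' : g' ≤ D') (hκ : 0 < κ) (hgk : κ * D ≤ g)
    (hC : 0 ≤ C) (hv' : |v'| ≤ C * D')
    (hg : |g - g'| ≤ ε) (hDD : |D - D'| ≤ ε)
    (hp : |g / D * v - g' / D' * v'| ≤ ε) :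
    |v - v'| ≤ (1 + 2 * C) / κ * ε := by
  have := ratio_est h0 h1 hD h0' h1' hC hv' hg hDD
  have e : g / D * (v - v') = (g / D * v - g' / D' * v') - (g / D - g' / D') * v' := by ring
  have q0 : 0 ≤ g / D := by positivity
  have q1 : κ ≤ g / D := (le_div_iff₀ hD).2 hgk
  have e2 : |g / D * (v - v')| ≤ ε + C * (ε + ε) := by
    rw [e]; exact (abs_sub _ _).trans (by linarith)
  rw [abs_mul, abs_of_nonneg q0] at e2
  have := mul_le_mul_of_nonneg_right q1 (abs_nonneg (v - v'))
  rw [div_mul_eq_mul_div, le_div_iff₀ hκ]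
  nlinarith

noncomputable def tt (m : ℕ) (i : Fin m) : ℝ := (2 * (i : ℝ) + 1) / (2 * m)

lemma tt_nonneg (m : ℕ) (i : Fin m) : 0 ≤ tt m i := by unfold tt; positivity

lemma tt_le (m : ℕ) (i : Fin m) : tt m i ≤ 1 := by
  have h : (i : ℝ) + 1 ≤ m := by exact_mod_cast i.2
  unfold tt
  have : (0:ℝ) ≤ i := by positivity
  rw [div_le_one (by linarith)]
  linarith

lemma pigeon {m : ℕ} (hm : 1 ≤ m) {A : Set ℝ} (hA : ZZ (m+1) A) (hD : 0 < sSup A) :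
    ∃ i : Fin m, 1 / (2 * m) * sSup A ≤ gg (tt m i) (sSup A) (lf (tt m i) A) (rf (tt m i) A) := by
  by_contra hcon
  push Not at hcon
  have hm0 : (0:ℝ) < m := by exact_mod_cast hm
  set D := sSup A with hDdef
  have H : ∀ i : Fin m, ∃ x ∈ A, |tt m i * D - x| < 1 / (2 * m) * D := by
    intro i
    obtain ⟨x, hx, e⟩ := (spl_exists hA (tt_nonneg m i) (tt_le m i)).g_ex
    exact ⟨x, hx, e ▸ hcon i⟩
  choose s hs hs2 using H
  have B : ∀ i : Fin m, (i : ℝ) * D < m * s i ∧ m * s i < (i + 1) * D := by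
    intro i
    have h := abs_lt.1 (hs2 i)
    have e1 : m * (tt m i * D) = i * D + D / 2 := by unfold tt; field_simp
    have e2 : m * (1 / (2 * m) * D) = D / 2 := by field_simp
    constructor
    · have := mul_lt_mul_of_pos_left h.2 hm0
      rw [mul_sub] at this; linarith
    · have := mul_lt_mul_of_pos_left h.1 hm0
      rw [mul_sub, mul_neg] at this; linarith
  have sinj : Function.Injective s := by
    have key : ∀ i j : Fin m, i < j → s i ≠ s j := by
      intro i j hij he
      have h1 := (B i).2
      have h2 := (B j).1
      rw [he] at h1
      have : (i : ℝ) + 1 ≤ j := by exact_mod_cast hij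
      nlinarith
    intro i j he
    rcases lt_trichotomy i j with h | h | h
    · exact absurd he (key i j h)
    · exact h
    · exact absurd he.symm (key j i h)
  obtain ⟨hf, hz, hn, hc⟩ := hA
  have hDm : D ∈ A := Set.Nonempty.csSup_mem ⟨0, hz⟩ hf
  have hsub : insert 0 (insert D (Set.range s)) ⊆ A := by
    rintro x (rfl | rfl | ⟨i, rfl⟩)
    · exact hz
    · exact hDm
    · exact hs i
  have n1 : D ∉ Set.range s := by
    rintro ⟨i, e⟩
    have h1 := (B i).2
    rw [e] at h1
    have : (i : ℝ) + 1 ≤ m := by exact_mod_cast i.2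
    nlinarith
  have n2 : (0:ℝ) ∉ insert D (Set.range s) := by
    rintro (h | ⟨i, e⟩)
    · linarith
    · have h1 := (B i).1
      rw [e] at h1
      have : (0:ℝ) ≤ i := by positivity
      nlinarith
  have hr : (Set.range s).ncard = m := by
    rw [← Set.image_univ, Set.ncard_image_of_injective _ sinj, Set.ncard_univ]; simp
  have := Set.ncard_le_ncard hsub hf
  rw [Set.ncard_insert_of_notMem n2 (by simp [Set.finite_range]), Set.ncard_insert_of_notMem n1 (Set.finite_range s), hr] at this
  omega

def SS : ℕ → ℕ
  | 0 => 0
  | m + 1 => (m + 1) * SS m + 1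

lemma SS_ge (m : ℕ) : m ≤ SS m := by
  induction m with
  | zero => simp
  | succ k ih => simp only [SS]; nlinarith

lemma SS_eq (m : ℕ) : (SS m : ℝ) = (∑ j ∈ Finset.range (m+1), (1:ℝ) ^ j / j.factorial - 1) * m.factorial := by
  induction m with
  | zero => simp [SS]
  | succ k ih =>
    rw [Finset.sum_range_succ, SS]
    push_cast
    rw [ih, Nat.factorial_succ]
    have : (k.factorial : ℝ) ≠ 0 := by positivity
    push_cast
    field_simp
    ring

lemma SS_le (m : ℕ) : SS m ≤ ⌊(Real.exp 1 - 1) * (m.factorial : ℝ)⌋₊ := by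
  apply Nat.le_floor
  rw [SS_eq]
  gcongr
  exact Real.sum_le_exp_of_nonneg zero_le_one _

def QQ (n : ℕ) : Prop := ∃ (ι : Type) (_ : Fintype ι) (f : Set ℝ → ι → ℝ) (L : ℝ),
  Fintype.card ι + 1 ≤ 2 * SS n ∧ 1 ≤ L ∧
  (∀ A, ZZ n A → ∀ j, |f A j| ≤ L * sSup A) ∧
  (∀ A B, ZZ n A → ZZ n B → ∀ δ, 0 ≤ δ → near δ A B → ∀ j, |f A j - f B j| ≤ L * δ) ∧
  (∀ A B, ZZ n A → ZZ n B → ∀ ε, 0 ≤ ε → (∀ j, |f A j - f B j| ≤ ε) → near (L * ε) A B)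

lemma ZZ_one {A : Set ℝ} (h : ZZ 1 A) : A = {0} := by
  obtain ⟨hf, hz, -, hc⟩ := h
  have := (Set.ncard_le_one hf).1 hc
  ext x
  simp only [Set.mem_singleton_iff]
  exact ⟨fun hx => this x hx 0 hz, fun hx => hx ▸ hz⟩

lemma QQ_one : QQ 1 := by
  refine ⟨Empty, inferInstance, fun _ j => 0, 1, by simp [SS], le_rfl, fun A _ j => j.elim,
    fun _ _ _ _ _ _ _ j => j.elim, fun A B hA hB ε he _ => ?_⟩
  rw [ZZ_one hA, ZZ_one hB]
  constructor <;> simp [he]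

noncomputable def FF {ι : Type} (m : ℕ) (f : Set ℝ → ι → ℝ) (A : Set ℝ) :
    Unit ⊕ (Fin m × (Fin 3 ⊕ ι)) → ℝ
  | Sum.inl _ => sSup A
  | Sum.inr (i, Sum.inl k) =>
    ![gg (tt m i) (sSup A) (lf (tt m i) A) (rf (tt m i) A),
      gg (tt m i) (sSup A) (lf (tt m i) A) (rf (tt m i) A) / sSup A * lf (tt m i) A,
      gg (tt m i) (sSup A) (lf (tt m i) A) (rf (tt m i) A) / sSup A * rf (tt m i) A] k
  | Sum.inr (i, Sum.inr j) =>
      gg (tt m i) (sSup A) (lf (tt m i) A) (rf (tt m i) A) / sSup A *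
        f (hh (lf (tt m i) A) (rf (tt m i) A) '' A) j

lemma sSup_image_le {A : Set ℝ} {t D l r : ℝ} (h : Spl A t D l r) : sSup (hh l r '' A) ≤ D := by
  apply csSup_le (Set.Nonempty.image _ ⟨0, h.zero⟩)
  rintro _ ⟨x, hx, rfl⟩
  exact (min_le_left _ _).trans (h.le x hx)

lemma QQ_succ {m : ℕ} (hm : 1 ≤ m) (h : QQ m) : QQ (m + 1) := by
  obtain ⟨ι, _, f, L, hcard, hL, hbd, hup, hlo⟩ := h
  have hm0 : (0:ℝ) < m := by exact_mod_cast hm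
  have hm1 : (1:ℝ) ≤ m := by exact_mod_cast hm
  have hL0 : 0 ≤ L := by linarith
  set κ : ℝ := 1 / (2 * m) with hκ
  have hκ0 : 0 < κ := by positivity
  -- basic bounds
  have S : ∀ A, ZZ (m+1) A → ∀ i, Spl A (tt m i) (sSup A) (lf (tt m i) A) (rf (tt m i) A) :=
    fun A hA i => spl_exists hA (tt_nonneg m i) (tt_le m i)
  have bl : ∀ A, ZZ (m+1) A → ∀ i, |lf (tt m i) A| ≤ L * sSup A := by
    intro A hA i
    have s := S A hA i
    have h1 := s.nn _ s.lmem
    have h2 := s.le _ s.lmem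
    rw [abs_of_nonneg h1]; nlinarith
  have br : ∀ A, ZZ (m+1) A → ∀ i, |rf (tt m i) A| ≤ L * sSup A := by
    intro A hA i
    have s := S A hA i
    have h1 := s.nn _ s.rmem
    have h2 := s.le _ s.rmem
    rw [abs_of_nonneg h1]; nlinarith
  have bf : ∀ A, ZZ (m+1) A → ∀ i, 0 < gg (tt m i) (sSup A) (lf (tt m i) A) (rf (tt m i) A) →
      ∀ j, |f (hh (lf (tt m i) A) (rf (tt m i) A) '' A) j| ≤ L * sSup A := by
    intro A hA i hg j
    have s := S A hA i
    exact (hbd _ (s.zz hA hg) j).trans (mul_le_mul_of_nonneg_left (sSup_image_le s) hL0)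
  set K : ℝ := 3 * L * ((1 + 2 * L) / κ) with hK
  have hdiv : 1 / κ = 2 * m := by rw [hκ]; field_simp
  have hK1 : 1 / κ ≤ K := by
    rw [hK, div_eq_mul_one_div (1 + 2 * L), hdiv]; nlinarith [mul_nonneg hL0 hm0.le]
  have hK11 : 0 ≤ K := le_trans (by positivity) hK1
  refine ⟨_, inferInstance, FF m f, 11 * L + K + 1 , ?_, by linarith, ?_, ?_, ?_⟩
  · simp only [Fintype.card_sum, Fintype.card_prod, Fintype.card_fin, Fintype.card_unit, SS]
    have := SS_ge m
    nlinarith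
  · intro A hA j
    have hD0 : 0 ≤ sSup A := Real.sSup_nonneg hA.2.2.1
    have hKD := mul_nonneg hK11 hD0
    have hLD := mul_nonneg hL0 hD0
    rcases j with _ | ⟨i, k | j⟩
    · simp only [FF]; rw [abs_of_nonneg hD0]; nlinarith
    · have s := S A hA i
      have g0 := s.g_nonneg
      have g1 := s.g_le
      have Lg := mul_le_mul_of_nonneg_left g1 hL0
      fin_cases k
      · simp [FF]; rw [abs_of_nonneg g0]; nlinarith
      · have := prod_bound g0 g1 hL0 (fun _ => bl A hA i)
        refine this.trans ?_
        nlinarith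
      · have := prod_bound g0 g1 hL0 (fun _ => br A hA i)
        refine this.trans ?_
        nlinarith
    · have s := S A hA i
      have g0 := s.g_nonneg
      have g1 := s.g_le
      have Lg := mul_le_mul_of_nonneg_left g1 hL0
      have := prod_bound g0 g1 hL0 (fun hg => bf A hA i hg j)
      simp only [FF]; nlinarith
  · intro A B hA hB δ hδ hn j
    have hKD := mul_nonneg hK11 hδ
    have hLD := mul_nonneg hL0 hδ
    have hLR : ∀ i, (4 * δ < gg (tt m i) (sSup A) (lf (tt m i) A) (rf (tt m i) A) ∨
        4 * δ < gg (tt m i) (sSup B) (lf (tt m i) B) (rf (tt m i) B)) →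
        |lf (tt m i) A - lf (tt m i) B| ≤ δ ∧ |rf (tt m i) A - rf (tt m i) B| ≤ δ := by
      rintro i (h | h)
      · exact lr_lip (S A hA i) (S B hB i) (tt_nonneg m i) (tt_le m i) hδ hn h
      · have := lr_lip (S B hB i) (S A hA i) (tt_nonneg m i) (tt_le m i) hδ hn.symm h
        rwa [abs_sub_comm, abs_sub_comm (rf _ B)] at this
    rcases j with _ | ⟨i, k | j⟩
    · have := D_lip (S A hA ⟨0, hm⟩) (S B hB ⟨0, hm⟩) hn
      simp only [FF]; nlinarith
    · have s := S A hA i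
      have s' := S B hB i
      have hD := D_lip s s' hn
      have hG := g_lip s s' (tt_nonneg m i) (tt_le m i) hn
      fin_cases k
      · simp only [FF]; simp; nlinarith
      · have := prod_lip (K := 3 * L) s.g_nonneg s.g_le s'.g_nonneg s'.g_le hδ (by linarith) hL0
          (fun _ => bl A hA i) (fun _ => bl B hB i) hG hD
          (fun h _ _ => (hLR i h).1.trans (by nlinarith))
        simp only [FF]; simp; nlinarith
      · have := prod_lip (K := 3 * L) s.g_nonneg s.g_le s'.g_nonneg s'.g_le hδ (by linarith) hL0
          (fun _ => br A hA i) (fun _ => br B hB i) hG hD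
          (fun h _ _ => (hLR i h).2.trans (by nlinarith))
        simp only [FF]; simp; nlinarith
    · have s := S A hA i
      have s' := S B hB i
      have hD := D_lip s s' hn
      have hG := g_lip s s' (tt_nonneg m i) (tt_le m i) hn
      have := prod_lip (K := 3 * L) s.g_nonneg s.g_le s'.g_nonneg s'.g_le hδ (by linarith) hL0
          (fun h => bf A hA i h j) (fun h => bf B hB i h j) hG hD
          (fun h p p' => by
            have := hup _ _ (s.zz hA p) (s'.zz hB p') (3 * δ) (by linarith)
              (near_image hn (hLR i h).1 (hLR i h).2) j
            linarith)
      simp only [FF]; nlinarith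
  · intro A B hA hB ε hε hj
    have hD : |sSup A - sSup B| ≤ ε := hj (Sum.inl ())
    have mono : ∀ {a b : ℝ}, a ≤ b → near a A B → near b A B := by
      intro a b hab hn
      exact ⟨fun x hx => (hn.1 x hx).imp fun y h => ⟨h.1, h.2.trans hab⟩,
        fun x hx => (hn.2 x hx).imp fun y h => ⟨h.1, h.2.trans hab⟩⟩
    have hKe := mul_nonneg hK11 hε
    have hLe := mul_nonneg hL0 hε
    have s0 := S A hA ⟨0, hm⟩
    have s0' := S B hB ⟨0, hm⟩
    by_cases hc : sSup A ≤ 1 / κ * ε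
    · have h1 : 1 / κ * ε ≤ K * ε := mul_le_mul_of_nonneg_right hK1 hε
      have h2 := (abs_le.1 hD).1
      refine mono (a := K * ε + ε) (by nlinarith) ⟨fun x hx => ⟨0, hB.2.1, ?_⟩, fun x hx => ⟨0, hA.2.1, ?_⟩⟩
      · rw [sub_zero, abs_of_nonneg (hA.2.2.1 x hx)]
        linarith [s0.le x hx]
      · rw [zero_sub, abs_neg, abs_of_nonneg (hB.2.2.1 x hx)]
        linarith [s0'.le x hx]
    · push Not at hc
      have hDp : 0 < sSup A := lt_of_le_of_lt (by positivity) hc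
      obtain ⟨i, hi⟩ := pigeon hm hA hDp
      rw [← hκ] at hi
      have s := S A hA i
      have s' := S B hB i
      have c0 : |gg (tt m i) (sSup A) (lf (tt m i) A) (rf (tt m i) A) -
        gg (tt m i) (sSup B) (lf (tt m i) B) (rf (tt m i) B)| ≤ ε := hj (Sum.inr (i, Sum.inl 0))
      have c1 := hj (Sum.inr (i, Sum.inl 1))
      have c2 := hj (Sum.inr (i, Sum.inl 2))
      have c3 := fun j => hj (Sum.inr (i, Sum.inr j))
      simp only [FF] at c1 c2 c3
      have hεκ : ε < κ * sSup A := by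
        rw [one_div, inv_mul_eq_div, div_lt_iff₀ hκ0] at hc
        linarith
      have p : 0 < gg (tt m i) (sSup A) (lf (tt m i) A) (rf (tt m i) A) := by linarith
      have p' : 0 < gg (tt m i) (sSup B) (lf (tt m i) B) (rf (tt m i) B) := by
        linarith [(abs_le.1 c0).2]
      have d1 := prod_rec s.g_nonneg s.g_le hDp s'.g_nonneg s'.g_le hκ0 hi hL0 (bl B hB i) c0 hD c1
      have d2 := prod_rec s.g_nonneg s.g_le hDp s'.g_nonneg s'.g_le hκ0 hi hL0 (br B hB i) c0 hD c2
      have d3 := fun j => prod_rec s.g_nonneg s.g_le hDp s'.g_nonneg s'.g_le hκ0 hi hL0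
        (bf B hB i p' j) c0 hD (c3 j)
      have he1 : 0 ≤ (1 + 2 * L) / κ * ε := by positivity
      have nr := hlo _ _ (s.zz hA p) (s'.zz hB p') _ he1 d3
      have le1 : (1 + 2 * L) / κ * ε ≤ L * ((1 + 2 * L) / κ * ε) := le_mul_of_one_le_left he1 hL
      refine mono ?_ (near_back s s' nr (d1.trans le1) (d2.trans le1))
      have : 3 * (L * ((1 + 2 * L) / κ * ε)) = K * ε := by rw [hK]; ring
      rw [this]; nlinarith

lemma QQ_all {n : ℕ} (hn : 1 ≤ n) : QQ n := by
  induction n, hn using Nat.le_induction with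
  | base => exact QQ_one
  | succ m hm ih => exact QQ_succ hm ih

lemma near_of_dist {A B : Set ℝ} (hA : A.Finite) (hB : B.Finite) (nA : A.Nonempty)
    (nB : B.Nonempty) : near (hausdorffDist A B) A B := by
  have fin : hausdorffEDist A B ≠ ⊤ :=
    hausdorffEDist_ne_top_of_nonempty_of_bounded nA nB hA.isBounded hB.isBounded
  constructor
  · intro x hx
    obtain ⟨y, hy, e⟩ := hB.isCompact.exists_infDist_eq_dist nB x
    exact ⟨y, hy, by
      rw [← Real.dist_eq, ← e]; exact infDist_le_hausdorffDist_of_mem hx fin⟩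
  · intro y hy
    obtain ⟨x, hx, e⟩ := hA.isCompact.exists_infDist_eq_dist nA y
    refine ⟨x, hx, ?_⟩
    rw [abs_sub_comm, ← Real.dist_eq, ← e, hausdorffDist_comm]
    exact infDist_le_hausdorffDist_of_mem hy (by rwa [hausdorffEDist_comm])

lemma dist_of_near {A B : Set ℝ} {δ : ℝ} (h0 : 0 ≤ δ) (h : near δ A B) :
    hausdorffDist A B ≤ δ := by
  apply hausdorffDist_le_of_mem_dist h0
  · intro x hx
    exact h.1 x hx
  · intro y hy
    exact h.symm.1 y hy

noncomputable def tr (A : Set ℝ) : Set ℝ := (fun x => x - sInf A) '' A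

lemma tr_zz {A : Set ℝ} {n : ℕ} (hA : A.Finite ∧ A.Nonempty ∧ A.ncard ≤ n) : ZZ n (tr A) := by
  obtain ⟨hf, hne, hc⟩ := hA
  refine ⟨hf.image _, ⟨sInf A, hne.csInf_mem hf, by simp⟩, ?_, (Set.ncard_image_le hf).trans hc⟩
  rintro _ ⟨x, hx, rfl⟩
  simpa using csInf_le hf.bddBelow hx

lemma tr_near {A B : Set ℝ} {δ η : ℝ} (h : near δ A B) (hi : |sInf A - sInf B| ≤ η) :
    near (δ + η) (tr A) (tr B) := by
  constructor
  · rintro _ ⟨x, hx, rfl⟩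
    obtain ⟨y, hy, e⟩ := h.1 x hx
    refine ⟨_, ⟨y, hy, rfl⟩, ?_⟩
    rw [abs_le] at *; constructor <;> linarith
  · rintro _ ⟨y, hy, rfl⟩
    obtain ⟨x, hx, e⟩ := h.2 y hy
    refine ⟨_, ⟨x, hx, rfl⟩, ?_⟩
    rw [abs_le] at *; constructor <;> linarith

lemma near_tr {A B : Set ℝ} {δ η : ℝ} (h : near δ (tr A) (tr B)) (hi : |sInf A - sInf B| ≤ η) :
    near (δ + η) A B := by
  constructor
  · intro x hx
    obtain ⟨_, ⟨y, hy, rfl⟩, e⟩ := h.1 _ ⟨x, hx, rfl⟩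
    refine ⟨y, hy, ?_⟩
    rw [abs_le] at *; constructor <;> linarith
  · intro y hy
    obtain ⟨_, ⟨x, hx, rfl⟩, e⟩ := h.2 _ ⟨y, hy, rfl⟩
    refine ⟨x, hx, ?_⟩
    rw [abs_le] at *; constructor <;> linarith

lemma inf_lip {A B : Set ℝ} {δ : ℝ} (hA : A.Finite) (hB : B.Finite) (nA : A.Nonempty)
    (nB : B.Nonempty) (h : near δ A B) : |sInf A - sInf B| ≤ δ := by
  obtain ⟨y, hy, h1⟩ := h.1 _ (nA.csInf_mem hA)
  obtain ⟨x, hx, h2⟩ := h.2 _ (nB.csInf_mem hB)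
  have := csInf_le hA.bddBelow hx
  have := csInf_le hB.bddBelow hy
  rw [abs_le] at *
  constructor <;> linarith

lemma norm_le_sum {m : ℕ} (v : EuclideanSpace ℝ (Fin m)) {M : ℝ} (h : ∀ i, |v i| ≤ M)
    (hM : 0 ≤ M) : ‖v‖ ≤ m * M := by
  rw [EuclideanSpace.norm_eq]
  apply Real.sqrt_le_iff.2 ⟨by positivity, ?_⟩
  calc ∑ i, ‖v i‖ ^ 2 ≤ ∑ _i : Fin m, M ^ 2 := by
        gcongr with i; exact h i
    _ = m * M ^ 2 := by simp
    _ ≤ (m * M) ^ 2 := by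
      rw [mul_pow]
      gcongr
      rcases Nat.eq_zero_or_pos m with h | h
      · simp [h]
      · have : (1:ℝ) ≤ m := by exact_mod_cast h
        nlinarith

end SymProd

open SymProd in
/-- **Theorem 1 (Kovalev).** The symmetric product `ℝ^(n)` (nonempty subsets of `ℝ` of
cardinality at most `n`, with the Hausdorff metric) admits a bi-Lipschitz embedding into
`ℝ^m` where `m = 2 ⌊(e-1) n!⌋`. -/
theorem symmetric_product_real_biLipschitz_embedding (n : ℕ) (hn : 1 ≤ n) :
    ∃ (L : ℝ) (f : {A : Set ℝ // A.Finite ∧ A.Nonempty ∧ A.ncard ≤ n} →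
        EuclideanSpace ℝ (Fin (2 * ⌊(Real.exp 1 - 1) * (n.factorial : ℝ)⌋₊))),
      1 ≤ L ∧ ∀ A B : {A : Set ℝ // A.Finite ∧ A.Nonempty ∧ A.ncard ≤ n},
        L⁻¹ * hausdorffDist A.1 B.1 ≤ ‖f A - f B‖ ∧
        ‖f A - f B‖ ≤ L * hausdorffDist A.1 B.1 := by
  obtain ⟨ι, _, f, L, hcard, hL, -, hup, hlo⟩ := QQ_all hn
  have hS := SS_le n
  generalize ⌊(Real.exp 1 - 1) * (n.factorial : ℝ)⌋₊ = q at hS ⊢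
  have hc : Fintype.card (Option ι) ≤ Fintype.card (Fin (2 * q)) := by
    simp only [Fintype.card_option, Fintype.card_fin]; omega
  obtain ⟨e⟩ := Function.Embedding.nonempty_of_card_le hc
  let G : Set ℝ → Option ι → ℝ := fun A o => o.elim (sInf A) (f (tr A))
  let F : Set ℝ → EuclideanSpace ℝ (Fin (2 * q)) := fun A =>
    WithLp.toLp 2 (Function.extend e (G A) 0)
  have Fe : ∀ A o, F A (e o) = G A o := fun A o => e.injective.extend_apply (G A) 0 o
  have Fn : ∀ A i, (¬ ∃ o, e o = i) → F A i = 0 := fun A i h =>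
    Function.extend_apply' (f := e) (G A) (0 : Fin (2 * q) → ℝ) i h
  have hq : (0:ℝ) ≤ ((2 * q : ℕ) : ℝ) := by positivity
  set Q : ℝ := ((2 * q : ℕ) : ℝ) with hQ
  set M : ℝ := L + 1 + Q * (2 * L) with hM
  have hQL : 0 ≤ Q * (2 * L) := by positivity
  have hM0 : 0 < M := by linarith
  refine ⟨M, fun A => F A.1, by linarith, ?_⟩
  rintro ⟨A, hA⟩ ⟨B, hB⟩
  have zA := tr_zz hA
  have zB := tr_zz hB
  simp only
  have hd : 0 ≤ hausdorffDist A B := hausdorffDist_nonneg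
  constructor
  · rw [inv_mul_le_iff₀ hM0]
    have comp : ∀ o, |G A o - G B o| ≤ ‖F A - F B‖ := by
      intro o
      have := PiLp.norm_apply_le (F A - F B) (e o)
      simpa [Fe] using this
    have h1 := hlo _ _ zA zB _ (norm_nonneg _) (fun j => comp (some j))
    have h2 := near_tr h1 (comp none)
    have h3 := dist_of_near (by positivity) h2
    nlinarith [mul_nonneg hQL (norm_nonneg (F A - F B))]
  · have hnr := near_of_dist hA.1 hB.1 hA.2.1 hB.2.1
    have hi := inf_lip hA.1 hB.1 hA.2.1 hB.2.1 hnr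
    have ht := tr_near hnr hi
    have hf := hup _ _ zA zB _ (by linarith) ht
    have : ‖F A - F B‖ ≤ Q * (2 * L * hausdorffDist A B) := by
      apply norm_le_sum _ _ (by positivity)
      intro i
      by_cases h : ∃ o, e o = i
      · obtain ⟨o, rfl⟩ := h
        rw [PiLp.sub_apply, Fe, Fe]
        rcases o with _ | j
        · change |sInf A - sInf B| ≤ _
          nlinarith
        · change |f (tr A) j - f (tr B) j| ≤ _
          linarith [hf j]
      · rw [PiLp.sub_apply, Fn _ _ h, Fn _ _ h]
        simp; positivity
    have := mul_nonneg (by linarith : 0 ≤ L + 1) hd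
    nlinarith
end

section
/- For all integers n ≥ 1 and d ≥ 1, the n-th symmetric product (ℝ^d)^(n) admits a bi-Lipschitz embedding into the Euclidean space ℝ^m, where m = 2·(n+1)^(d−1)·⌊(e−1)·n!⌋. That is, there exist a constant L ≥ 1 and a map f : (ℝ^d)^(n) → ℝ^m such that L⁻¹·d_H(A,B) ≤ ‖f(A) − f(B)‖ ≤ L·d_H(A,B) for all A, B ∈ (ℝ^d)^(n). -/
open Metric

namespace SymProd

/-- The set enumerated by the first `k+1` terms. -/
def R (k : ℕ) (x : ℕ → ℝ) : Set ℝ := Set.range (fun m : Fin (k + 1) => x m)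

/-- One-sided closeness. -/
def Near (k : ℕ) (x y : ℕ → ℝ) (ε : ℝ) : Prop := ∀ i ≤ k, ∃ j ≤ k, |x i - y j| ≤ ε

def gap (k : ℕ) (x : ℕ → ℝ) : Fin k → ℝ := fun i => x (i + 1) - x i

noncomputable def srt (k : ℕ) (x : ℕ → ℝ) : Fin k → ℝ := gap k x ∘ Tuple.sort (gap k x)

noncomputable def recon (k : ℕ) (v : ℝ) (s : Fin k → ℝ) (σ : Equiv.Perm (Fin k)) :
    Fin (k + 1) → ℝ := fun m => v + ∑ i : Fin k, if i.val < m.val then s (σ i) else 0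

noncomputable def G (k : ℕ) (x : ℕ → ℝ) : Unit ⊕ (Fin k ⊕ Equiv.Perm (Fin k)) → ℝ :=
  Sum.elim (fun _ => x 0) (Sum.elim (srt k x)
    (fun σ => hausdorffDist (R k x) (Set.range (recon k (x 0) (srt k x) σ))))

lemma exists_near {X : Type*} [MetricSpace X] {A B : Set X} (hA : A.Finite) (hA' : A.Nonempty)
    (hB : B.Finite) (hB' : B.Nonempty) {a : X} (ha : a ∈ A) :
    ∃ b ∈ B, dist a b ≤ hausdorffDist A B := by
  obtain ⟨b, hb, h⟩ := hB.isCompact.exists_infDist_eq_dist hB' a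
  refine ⟨b, hb, ?_⟩
  rw [← h]
  exact infDist_le_hausdorffDist_of_mem ha
    (hausdorffEDist_ne_top_of_nonempty_of_bounded hA' hB' hA.isBounded hB.isBounded)

lemma R_finite (k : ℕ) (x : ℕ → ℝ) : (R k x).Finite := Set.finite_range _
lemma R_nonempty (k : ℕ) (x : ℕ → ℝ) : (R k x).Nonempty := Set.range_nonempty _

lemma near_of (k : ℕ) (x y : ℕ → ℝ) : Near k x y (hausdorffDist (R k x) (R k y)) := by
  intro i hi
  obtain ⟨b, ⟨j, rfl⟩, h⟩ := exists_near (R_finite k x) (R_nonempty k x) (R_finite k y)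
    (R_nonempty k y) (a := x i) ⟨⟨i, by omega⟩, rfl⟩
  exact ⟨j, by omega, h⟩

lemma hausdorff_range_le {ι : Type*} [Nonempty ι] (u v : ι → ℝ) (r : ℝ)
    (h : ∀ i, |u i - v i| ≤ r) : hausdorffDist (Set.range u) (Set.range v) ≤ r := by
  have hr : 0 ≤ r := (abs_nonneg _).trans (h (Classical.arbitrary ι))
  apply hausdorffDist_le_of_mem_dist hr
  · rintro _ ⟨i, rfl⟩
    exact ⟨_, ⟨i, rfl⟩, h i⟩
  · rintro _ ⟨i, rfl⟩
    exact ⟨_, ⟨i, rfl⟩, by rw [dist_comm]; exact h i⟩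

lemma first_close {k : ℕ} {x y : ℕ → ℝ} (hx : Monotone x) (hy : Monotone y) {ε : ℝ}
    (h1 : Near k x y ε) (h2 : Near k y x ε) : |x 0 - y 0| ≤ ε := by
  obtain ⟨j, -, hj⟩ := h1 0 (by omega)
  obtain ⟨i, -, hi⟩ := h2 0 (by omega)
  have := hx (Nat.zero_le i)
  have := hy (Nat.zero_le j)
  rw [abs_le] at *
  constructor <;> linarith

lemma count_le {k : ℕ} {x y : ℕ → ℝ} (hx : Monotone x) (hy : Monotone y) {ε t : ℝ}
    (h1 : Near k x y ε) (h2 : Near k y x ε) (ht : 0 ≤ t) :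
    (Finset.univ.filter (fun i : Fin k => t + 2 * ε < gap k x i)).card ≤
    (Finset.univ.filter (fun i : Fin k => t < gap k y i)).card := by
  have key : ∀ i : Fin k, t + 2 * ε < gap k x i →
      ∃ j : Fin k, y j ≤ x i + ε ∧ x i + ε < y (j + 1) ∧ t < gap k y j := by
    intro i hi
    unfold gap at *
    obtain ⟨p, hp, hpy⟩ := h1 i (by omega)
    obtain ⟨q, hq, hqy⟩ := h1 (i + 1) (by omega)
    rw [abs_le] at hpy hqy
    have hex : ∃ m, x i + ε < y m := ⟨q, by linarith⟩
    classical
    have hm := Nat.find_spec hex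
    have hmin : ∀ m, m < Nat.find hex → y m ≤ x i + ε := fun m h => not_lt.1 (Nat.find_min hex h)
    have hle : Nat.find hex ≤ q := Nat.find_min' hex (by linarith)
    generalize Nat.find hex = m at *
    have hpm : p < m := by
      by_contra hc
      have := hy (not_lt.1 hc)
      linarith
    obtain ⟨j, rfl⟩ : ∃ j, m = j + 1 := ⟨m - 1, by omega⟩
    have hj := hmin j (by omega)
    refine ⟨⟨j, by omega⟩, hj, hm, ?_⟩
    obtain ⟨r, hr, hry⟩ := h2 (j + 1) (by omega)
    rw [abs_le] at hry
    have hir : (i : ℕ) + 1 ≤ r := by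
      by_contra hc
      have := hx (show r ≤ (i : ℕ) by omega)
      linarith
    have := hx hir
    simp only
    linarith
  choose! φ hφ using key
  apply Finset.card_le_card_of_injOn φ
  · intro i hi
    simp at hi ⊢
    exact (hφ i hi).2.2
  · have lt : ∀ a b : Fin k, t + 2 * ε < gap k x a → t + 2 * ε < gap k x b → a < b →
        φ a ≠ φ b := by
      intro a b ha hb hab he
      obtain ⟨ha1, ha2, -⟩ := hφ a ha
      obtain ⟨hb1, hb2, -⟩ := hφ b hb
      rw [← he] at hb1 hb2
      obtain ⟨q, hq, hqy⟩ := h1 b (by omega)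
      rw [abs_le] at hqy
      have h3 := hx (show (a : ℕ) + 1 ≤ b from hab)
      unfold gap at ha
      have h4 : (φ a : ℕ) + 1 ≤ q := by
        by_contra hc
        have := hy (show q ≤ (φ a : ℕ) by omega)
        linarith
      have h5 : q < (φ a : ℕ) + 1 := by
        by_contra hc
        have := hy (not_lt.1 hc)
        -- y (φ a + 1) ≤ y q ≤ x b + ε
        linarith
      omega
    intro a ha b hb hab
    simp at ha hb
    rcases lt_trichotomy a b with h | h | h
    · exact absurd hab (lt a b ha hb h)
    · exact h
    · exact absurd hab.symm (lt b a hb ha h)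

lemma card_srt (k : ℕ) (x : ℕ → ℝ) (t : ℝ) :
    (Finset.univ.filter (fun i : Fin k => t < srt k x i)).card =
    (Finset.univ.filter (fun i : Fin k => t < gap k x i)).card := by
  apply Finset.card_bij (fun i _ => Tuple.sort (gap k x) i)
  · intro a ha
    rw [Finset.mem_filter] at ha ⊢
    exact ⟨Finset.mem_univ _, ha.2⟩
  · intro a _ b _ h; simpa using h
  · intro b hb
    rw [Finset.mem_filter] at hb
    refine ⟨(Tuple.sort (gap k x)).symm b, ?_, by simp⟩
    rw [Finset.mem_filter]
    exact ⟨Finset.mem_univ _, by simpa only [srt, Function.comp, Equiv.apply_symm_apply] using hb.2⟩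

lemma srt_le {k : ℕ} {x y : ℕ → ℝ} (hx : Monotone x) (hy : Monotone y) {ε : ℝ}
    (h1 : Near k x y ε) (h2 : Near k y x ε) (j : Fin k) : srt k x j ≤ srt k y j + 2 * ε := by
  by_contra! hc
  have h0 : 0 ≤ srt k y j := by
    exact sub_nonneg.2 (hy (Nat.le_succ (Tuple.sort (gap k y) j : ℕ)))
  have hcount := count_le hx hy h1 h2 h0
  rw [← card_srt, ← card_srt] at hcount
  have mx : Monotone (srt k x) := Tuple.monotone_sort _
  have my : Monotone (srt k y) := Tuple.monotone_sort _
  have a1 : (Finset.Ici j).card ≤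
      (Finset.univ.filter (fun i : Fin k => srt k y j + 2 * ε < srt k x i)).card := by
    apply Finset.card_le_card
    intro i hi
    simp at hi ⊢
    exact hc.trans_le (mx hi)
  have a2 : (Finset.univ.filter (fun i : Fin k => srt k y j < srt k y i)).card ≤
      (Finset.Ioi j).card := by
    apply Finset.card_le_card
    intro i hi
    simp at hi ⊢
    exact my.reflect_lt hi
  have a3 : (Finset.Ioi j).card < (Finset.Ici j).card := by
    apply Finset.card_lt_card
    rw [Finset.ssubset_iff_of_subset Finset.Ioi_subset_Ici_self]
    exact ⟨j, by simp, by simp⟩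
  omega

lemma srt_close {k : ℕ} {x y : ℕ → ℝ} (hx : Monotone x) (hy : Monotone y) {ε : ℝ}
    (h1 : Near k x y ε) (h2 : Near k y x ε) (j : Fin k) : |srt k x j - srt k y j| ≤ 2 * ε := by
  have := srt_le hx hy h1 h2 j
  have := srt_le hy hx h2 h1 j
  rw [abs_le]; constructor <;> linarith

lemma recon_close {k : ℕ} {v w : ℝ} {s s' : Fin k → ℝ} (σ : Equiv.Perm (Fin k)) {ε : ℝ}
    (hε : 0 ≤ ε) (hv : |v - w| ≤ ε) (hs : ∀ j, |s j - s' j| ≤ ε) :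
    hausdorffDist (Set.range (recon k v s σ)) (Set.range (recon k w s' σ)) ≤ (k + 1) * ε := by
  apply hausdorff_range_le
  intro m
  unfold recon
  have : (∑ i : Fin k, if i.val < m.val then s (σ i) else 0) -
      (∑ i : Fin k, if i.val < m.val then s' (σ i) else 0) =
      ∑ i : Fin k, if i.val < m.val then s (σ i) - s' (σ i) else 0 := by
    rw [← Finset.sum_sub_distrib]
    apply Finset.sum_congr rfl
    intro i _
    split_ifs <;> simp
  have h2 : |∑ i : Fin k, if i.val < m.val then s (σ i) - s' (σ i) else 0| ≤ k * ε := by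
    refine (Finset.abs_sum_le_sum_abs _ _).trans ?_
    have : ∑ i : Fin k, |if i.val < m.val then s (σ i) - s' (σ i) else 0| ≤ ∑ i : Fin k, ε := by
      apply Finset.sum_le_sum
      intro i _
      split_ifs
      · exact hs _
      · simpa using hε
    simpa using this
  rw [← this] at h2
  rw [abs_le] at *
  constructor <;> linarith [h2.1, h2.2, hv.1, hv.2]

lemma recon_eq (k : ℕ) (x : ℕ → ℝ) :
    Set.range (recon k (x 0) (srt k x) (Tuple.sort (gap k x)).symm) = R k x := by
  unfold R
  congr 1
  funext m
  unfold recon srt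
  simp only [Function.comp, Equiv.apply_symm_apply]
  have := Fin.sum_univ_eq_sum_range (fun i => if i < m.val then x (i + 1) - x i else 0) k
  simp only [gap]
  rw [this, ← Finset.sum_filter]
  have h : (Finset.range k).filter (fun i => i < m.val) = Finset.range m.val := by
    ext i; simp; omega
  rw [h, Finset.sum_range_sub]
  ring

lemma haus_tri {A B C : Set ℝ} (hA : A.Finite) (hA' : A.Nonempty)
    (hB : B.Finite) (hB' : B.Nonempty) :
    hausdorffDist A C ≤ hausdorffDist A B + hausdorffDist B C :=
  hausdorffDist_triangle
    (hausdorffEDist_ne_top_of_nonempty_of_bounded hA' hB' hA.isBounded hB.isBounded)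

lemma G_lip {k : ℕ} {x y : ℕ → ℝ} (hx : Monotone x) (hy : Monotone y) (c) :
    |G k x c - G k y c| ≤ (2 * k + 4) * hausdorffDist (R k x) (R k y) := by
  set ε := hausdorffDist (R k x) (R k y) with hε
  have hε0 : 0 ≤ ε := hausdorffDist_nonneg
  have h1 := near_of k x y
  have h2 := near_of k y x
  rw [hausdorffDist_comm] at h2
  rw [← hε] at h1 h2
  have f := first_close hx hy h1 h2
  have s := srt_close hx hy h1 h2
  have hk : 0 ≤ (k : ℝ) * ε := by positivity
  rcases c with c | c | σ
  · simp only [G, Sum.elim_inl]; linarith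
  · simp only [G, Sum.elim_inl, Sum.elim_inr]; linarith [s c]
  · simp only [G, Sum.elim_inr]
    have r := recon_close σ (by linarith : 0 ≤ 2 * ε) (by linarith) s
    set U := Set.range (recon k (x 0) (srt k x) σ)
    set V := Set.range (recon k (y 0) (srt k y) σ)
    have U1 : U.Finite := Set.finite_range _
    have U2 : U.Nonempty := Set.range_nonempty _
    have V1 : V.Finite := Set.finite_range _
    have V2 : V.Nonempty := Set.range_nonempty _
    have t1 := haus_tri (C := U) (R_finite k x) (R_nonempty k x) (R_finite k y) (R_nonempty k y)
    have t2 := haus_tri (C := U) (R_finite k y) (R_nonempty k y) V1 V2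
    have t3 := haus_tri (C := V) (R_finite k y) (R_nonempty k y) (R_finite k x) (R_nonempty k x)
    have t4 := haus_tri (C := V) (R_finite k x) (R_nonempty k x) U1 U2
    rw [hausdorffDist_comm (s := V)] at t2
    rw [hausdorffDist_comm (s := R k y) (t := R k x)] at t3
    rw [abs_le]
    constructor <;> linarith

lemma G_sep {k : ℕ} {x y : ℕ → ℝ} {ε : ℝ} (h : ∀ c, |G k x c - G k y c| ≤ ε) :
    hausdorffDist (R k x) (R k y) ≤ (k + 2) * ε := by
  have hε : 0 ≤ ε := (abs_nonneg _).trans (h (Sum.inl ()))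
  have f := h (Sum.inl ())
  have s := fun j => h (Sum.inr (Sum.inl j))
  have p := h (Sum.inr (Sum.inr (Tuple.sort (gap k x)).symm))
  simp only [G, Sum.elim_inl, Sum.elim_inr] at f s p
  have r := recon_close (Tuple.sort (gap k x)).symm hε f s
  rw [recon_eq] at p r
  rw [hausdorffDist_self_zero] at p
  set V := Set.range (recon k (y 0) (srt k y) (Tuple.sort (gap k x)).symm)
  have t := haus_tri (A := R k x) (B := V) (C := R k y) (R_finite k x) (R_nonempty k x)
    (Set.finite_range _) (Set.range_nonempty _)
  rw [hausdorffDist_comm (s := V)] at t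
  rw [abs_le] at p
  linarith

lemma exists_enum (k : ℕ) (A : Set ℝ) (h1 : A.Finite) (h2 : A.Nonempty) (h3 : A.ncard ≤ k + 1) :
    ∃ x : ℕ → ℝ, Monotone x ∧ R k x = A := by
  obtain ⟨r, hr⟩ : ∃ r, h1.toFinset.card = r + 1 := by
    have : h1.toFinset.card ≠ 0 := by
      simpa using h2.ne_empty
    exact ⟨_, (Nat.succ_pred_eq_of_ne_zero this).symm⟩
  rw [Set.ncard_eq_toFinset_card A h1, hr] at h3
  let e := h1.toFinset.orderEmbOfFin hr
  refine ⟨fun m => e ⟨min m r, by omega⟩, ?_, ?_⟩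
  · intro a b hab
    apply e.monotone
    simp only [Fin.mk_le_mk]
    omega
  · have he : Set.range e = A := by
      simp [e]
    refine Eq.trans ?_ he
    ext z
    constructor
    · rintro ⟨m, rfl⟩
      exact ⟨_, rfl⟩
    · rintro ⟨m, rfl⟩
      refine ⟨⟨m, by omega⟩, ?_⟩
      simp only
      congr 1
      ext
      simp
      omega

lemma line (k : ℕ) : ∃ (K : ℝ) (F : Set ℝ → Unit ⊕ (Fin k ⊕ Equiv.Perm (Fin k)) → ℝ), 0 ≤ K ∧
    ∀ A B : Set ℝ, A.Finite → A.Nonempty → A.ncard ≤ k + 1 → B.Finite → B.Nonempty →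
      B.ncard ≤ k + 1 → (∀ c, |F A c - F B c| ≤ K * hausdorffDist A B) ∧
      ∀ ε, (∀ c, |F A c - F B c| ≤ ε) → hausdorffDist A B ≤ K * ε := by
  have : ∀ A : Set ℝ, ∃ x : ℕ → ℝ, A.Finite → A.Nonempty → A.ncard ≤ k + 1 →
      Monotone x ∧ R k x = A := by
    intro A
    by_cases h : A.Finite ∧ A.Nonempty ∧ A.ncard ≤ k + 1
    · obtain ⟨x, hx⟩ := exists_enum k A h.1 h.2.1 h.2.2
      exact ⟨x, fun _ _ _ => hx⟩
    · exact ⟨0, fun a b c => absurd ⟨a, b, c⟩ h⟩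
  choose x hx using this
  refine ⟨2 * k + 4, fun A => G k (x A), by positivity, ?_⟩
  intro A B a1 a2 a3 b1 b2 b3
  obtain ⟨mA, eA⟩ := hx A a1 a2 a3
  obtain ⟨mB, eB⟩ := hx B b1 b2 b3
  constructor
  · intro c
    have := G_lip (k := k) mA mB c
    rwa [eA, eB] at this
  · intro ε h
    have h0 : 0 ≤ ε := (abs_nonneg _).trans (h (Sum.inl ()))
    have := G_sep h
    rw [eA, eB] at this
    have : 0 ≤ (k : ℝ) * ε := by positivity
    linarith

/-- Moment-curve functionals. -/
noncomputable def ell (d : ℕ) (p : ℕ) (v : EuclideanSpace ℝ (Fin d)) : ℝ :=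
  ∑ j : Fin d, (p : ℝ) ^ (j : ℕ) * v j

lemma ell_sub (d p : ℕ) (v w : EuclideanSpace ℝ (Fin d)) :
    ell d p (v - w) = ell d p v - ell d p w := by
  simp [ell, mul_sub, Finset.sum_sub_distrib]

lemma ell_bound (d p : ℕ) : ∃ C : ℝ, 0 ≤ C ∧ ∀ v, |ell d p v| ≤ C * ‖v‖ := by
  refine ⟨∑ j : Fin d, (p : ℝ) ^ (j : ℕ), by positivity, fun v => ?_⟩
  unfold ell
  rw [Finset.sum_mul]
  refine (Finset.abs_sum_le_sum_abs _ _).trans (Finset.sum_le_sum fun j _ => ?_)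
  rw [abs_mul, abs_of_nonneg (by positivity : (0 : ℝ) ≤ (p : ℝ) ^ (j : ℕ))]
  exact mul_le_mul_of_nonneg_left (PiLp.norm_apply_le v j) (by positivity)

lemma ell_inv (d : ℕ) (e : Fin d → ℕ) (he : Function.Injective e) :
    ∃ C : ℝ, 0 ≤ C ∧ ∀ v ε, 0 ≤ ε → (∀ i, |ell d (e i) v| ≤ ε) → ‖v‖ ≤ C * ε := by
  let T : EuclideanSpace ℝ (Fin d) →ₗ[ℝ] (Fin d → ℝ) :=
    (Matrix.vandermonde (fun i => (e i : ℝ))).mulVecLin ∘ₗ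
      (WithLp.linearEquiv 2 ℝ (Fin d → ℝ)).toLinearMap
  have hT : ∀ v i, T v i = ell d (e i) v := by
    intro v i
    simp [T, ell, Matrix.mulVec, dotProduct, Matrix.vandermonde]
  have hinj : LinearMap.ker T = ⊥ := by
    rw [LinearMap.ker_eq_bot]
    have hdet : IsUnit (Matrix.vandermonde (fun i => (e i : ℝ))) := by
      rw [Matrix.isUnit_iff_isUnit_det, isUnit_iff_ne_zero, Matrix.det_vandermonde_ne_zero_iff]
      exact fun a b h => he (Nat.cast_injective h)
    have := Matrix.mulVec_injective_of_isUnit hdet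
    exact this.comp (WithLp.linearEquiv 2 ℝ (Fin d → ℝ)).injective
  obtain ⟨K, -, hK⟩ := LinearMap.exists_antilipschitzWith T hinj
  refine ⟨K, K.2, fun v ε hε h => ?_⟩
  have h1 := hK.le_mul_dist v 0
  rw [map_zero, dist_zero_right, dist_zero_right] at h1
  refine h1.trans (mul_le_mul_of_nonneg_left ?_ K.2)
  rw [pi_norm_le_iff_of_nonneg hε]
  intro i
  rw [hT]; exact h i

lemma dim_bound (n : ℕ) (hn : 1 ≤ n) :
    1 + ((n - 1) + (n - 1).factorial) ≤ 2 * ⌊(Real.exp 1 - 1) * (n.factorial : ℝ)⌋₊ := by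
  have h1 : n.factorial ≤ ⌊(Real.exp 1 - 1) * (n.factorial : ℝ)⌋₊ := by
    apply Nat.le_floor
    have := Real.add_one_le_exp (1 : ℝ)
    have : (0 : ℝ) ≤ n.factorial := by positivity
    nlinarith
  obtain ⟨k, rfl⟩ : ∃ k, n = k + 1 := ⟨n - 1, by omega⟩
  have h2 : 0 < k.factorial := Nat.factorial_pos k
  have h3 : k + k.factorial ≤ (k + 1).factorial := by
    rw [Nat.factorial_succ]; nlinarith
  have h4 : 0 < (k + 1).factorial := Nat.factorial_pos _
  simp only [Nat.add_sub_cancel]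
  omega

lemma dir_bound (n d : ℕ) (hd : 1 ≤ d) : n * (d - 1) < (n + 1) ^ (d - 1) := by
  have := one_add_mul_le_pow (a := (n : ℤ)) (by omega) (d - 1)
  have h2 : 1 + (d - 1) * n ≤ (1 + n) ^ (d - 1) := by
    exact_mod_cast this
  rw [add_comm n 1]; nlinarith

/-- Separation by projections. -/
lemma proj_sep (n d P : ℕ) (hd : 1 ≤ d) (hP : n * (d - 1) < P) :
    ∃ C : ℝ, 0 ≤ C ∧ ∀ A B : Set (EuclideanSpace ℝ (Fin d)), B.Finite → B.ncard ≤ n →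
      ∀ ε, 0 ≤ ε → (∀ p : Fin P, ∀ a ∈ A, ∃ b ∈ B, |ell d p (a - b)| ≤ ε) →
      ∀ a ∈ A, ∃ b ∈ B, dist a b ≤ C * ε := by
  have : ∀ e : Fin d → Fin P, ∃ C : ℝ, 0 ≤ C ∧ (Function.Injective e →
      ∀ v ε, 0 ≤ ε → (∀ i, |ell d (e i) v| ≤ ε) → ‖v‖ ≤ C * ε) := by
    intro e
    by_cases he : Function.Injective e
    · obtain ⟨C, h0, h⟩ := ell_inv d (fun i => (e i : ℕ)) (Fin.val_injective.comp he)
      exact ⟨C, h0, fun _ => h⟩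
    · exact ⟨0, le_rfl, fun h => absurd h he⟩
  choose C hC0 hC using this
  refine ⟨∑ e, C e, Finset.sum_nonneg fun e _ => hC0 e, ?_⟩
  intro A B hB hBn ε hε h a ha
  classical
  choose b hb hab using fun p => h p a ha
  obtain ⟨y, hy, hcard⟩ := Finset.exists_lt_card_fiber_of_mul_lt_card_of_maps_to
    (s := (Finset.univ : Finset (Fin P))) (t := hB.toFinset) (f := b) (n := d - 1)
    (by intro p _; simpa using hb p)
    (by
      rw [Finset.card_univ, Fintype.card_fin, ← Set.ncard_eq_toFinset_card B hB]
      exact (Nat.mul_le_mul_right _ hBn).trans_lt hP)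
  obtain ⟨S, hS, hSc⟩ := Finset.exists_subset_card_eq (Nat.le_of_pred_lt hcard)
  let e : Fin d → Fin P := S.orderEmbOfFin hSc
  have he : Function.Injective e := (S.orderEmbOfFin hSc).injective
  refine ⟨y, by simpa using hy, ?_⟩
  rw [dist_eq_norm]
  refine (hC e he (a - y) ε hε fun i => ?_).trans (mul_le_mul_of_nonneg_right ?_ hε)
  · have hm : e i ∈ S := Finset.orderEmbOfFin_mem S hSc i
    have := hS hm
    simp only [Finset.mem_filter] at this
    rw [← this.2]
    exact hab _
  · exact Finset.single_le_sum (f := C) (fun e _ => hC0 e) (Finset.mem_univ e)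

end SymProd

open SymProd in
/-- **Theorem 2 (Kovalev).** The symmetric product `(ℝ^d)^(n)` admits a bi-Lipschitz
embedding into `ℝ^m` where `m = 2 (n+1)^(d-1) ⌊(e-1) n!⌋`. -/
theorem symmetric_product_euclidean_biLipschitz_embedding (n d : ℕ) (hn : 1 ≤ n) (hd : 1 ≤ d) :
    ∃ (L : ℝ) (f : {A : Set (EuclideanSpace ℝ (Fin d)) // A.Finite ∧ A.Nonempty ∧ A.ncard ≤ n} →
        EuclideanSpace ℝ (Fin (2 * (n + 1) ^ (d - 1) * ⌊(Real.exp 1 - 1) * (n.factorial : ℝ)⌋₊))),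
      1 ≤ L ∧ ∀ A B : {A : Set (EuclideanSpace ℝ (Fin d)) // A.Finite ∧ A.Nonempty ∧ A.ncard ≤ n},
        L⁻¹ * hausdorffDist A.1 B.1 ≤ ‖f A - f B‖ ∧
        ‖f A - f B‖ ≤ L * hausdorffDist A.1 B.1 := by
  have hdim := dim_bound n hn
  have hdir := dir_bound n d hd
  obtain ⟨k, rfl⟩ : ∃ k, n = k + 1 := ⟨n - 1, by omega⟩
  simp only [Nat.add_sub_cancel] at hdim
  generalize hM : 2 * (k + 1 + 1) ^ (d - 1) *
    ⌊(Real.exp 1 - 1) * ((k + 1).factorial : ℝ)⌋₊ = M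
  generalize hP : (k + 1 + 1) ^ (d - 1) = P at *
  have hP0 : 0 < P := by omega
  haveI : Nonempty (Fin P) := ⟨⟨0, hP0⟩⟩
  have hcard : Fintype.card (Fin P × (Unit ⊕ (Fin k ⊕ Equiv.Perm (Fin k)))) ≤
      Fintype.card (Fin M) := by
    simp only [Fintype.card_prod, Fintype.card_sum, Fintype.card_fin, Fintype.card_unit,
      Fintype.card_perm]
    calc P * (1 + (k + k.factorial)) ≤ P * _ := Nat.mul_le_mul_left _ hdim
      _ = M := by rw [← hM]; ring
  obtain ⟨emb⟩ := Function.Embedding.nonempty_of_card_le hcard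
  obtain ⟨g, hg⟩ : ∃ g : Fin M → Fin P × (Unit ⊕ (Fin k ⊕ Equiv.Perm (Fin k))),
      Function.Surjective g := ⟨_, Function.invFun_surjective emb.injective⟩
  obtain ⟨K, F, hK0, hF⟩ := line k
  obtain ⟨C, hC0, hC⟩ := proj_sep (k + 1) d P hd hdir
  choose D hD0 hD using ell_bound d
  let D' : ℝ := ∑ p : Fin P, D p
  have hD'0 : 0 ≤ D' := Finset.sum_nonneg fun p _ => hD0 p
  have hD' : ∀ p : Fin P, ∀ v, |ell d p v| ≤ D' * ‖v‖ := fun p v =>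
    (hD p v).trans (mul_le_mul_of_nonneg_right
      (Finset.single_le_sum (f := fun p : Fin P => D p) (fun p _ => hD0 p) (Finset.mem_univ p))
      (norm_nonneg _))
  let L : ℝ := 1 + (M + 1) * (K * D') + C * K
  have hL1 : 1 ≤ L := by
    have : 0 ≤ (M + 1) * (K * D') := by positivity
    have : 0 ≤ C * K := by positivity
    simp only [L]; linarith
  refine ⟨L, fun A => WithLp.toLp 2 (fun c => F (ell d (g c).1 '' A.1) (g c).2), hL1, ?_⟩
  rintro ⟨A, a1, a2, a3⟩ ⟨B, b1, b2, b3⟩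
  simp only
  have hline := fun p : Fin P => hF (ell d p '' A) (ell d p '' B) (a1.image _) (a2.image _)
    ((Set.ncard_image_le a1).trans a3) (b1.image _) (b2.image _)
    ((Set.ncard_image_le b1).trans b3)
  set δ := hausdorffDist A B with hδ
  have hδ0 : 0 ≤ δ := hausdorffDist_nonneg
  constructor
  · set ε := ‖WithLp.toLp 2 (fun c => F (ell d (g c).1 '' A) (g c).2) -
      WithLp.toLp 2 (fun c => F (ell d (g c).1 '' B) (g c).2)‖ with hε
    have hε0 : 0 ≤ ε := norm_nonneg _
    have hcoord : ∀ p : Fin P, ∀ c, |F (ell d p '' A) c - F (ell d p '' B) c| ≤ ε := by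
      intro p c
      obtain ⟨i, hi⟩ := hg (p, c)
      have := PiLp.norm_apply_le (WithLp.toLp 2 (fun c => F (ell d (g c).1 '' A) (g c).2) -
        WithLp.toLp 2 (fun c => F (ell d (g c).1 '' B) (g c).2)) i
      simpa [hi] using this
    have hh := fun p => (hline p).2 ε (hcoord p)
    have hmain : δ ≤ C * (K * ε) := by
      apply hausdorffDist_le_of_mem_dist (by positivity)
      · apply hC A B b1 b3 _ (by positivity)
        intro p a ha
        obtain ⟨_, ⟨b, hb, rfl⟩, h⟩ := exists_near (a1.image (ell d p)) (a2.image _)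
          (b1.image (ell d p)) (b2.image _) (Set.mem_image_of_mem _ ha)
        refine ⟨b, hb, ?_⟩
        rw [ell_sub]
        exact h.trans (hh p)
      · apply hC B A a1 a3 _ (by positivity)
        intro p a ha
        obtain ⟨_, ⟨b, hb, rfl⟩, h⟩ := exists_near (b1.image (ell d p)) (b2.image _)
          (a1.image (ell d p)) (a2.image _) (Set.mem_image_of_mem _ ha)
        refine ⟨b, hb, ?_⟩
        rw [ell_sub]
        rw [hausdorffDist_comm] at h
        exact h.trans (hh p)
    rw [inv_mul_le_iff₀ (by linarith)]
    have : C * K ≤ L := by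
      have : 0 ≤ (M + 1) * (K * D') := by positivity
      simp only [L]; linarith
    nlinarith
  · have hproj : ∀ p : Fin P, hausdorffDist (ell d p '' A) (ell d p '' B) ≤ D' * δ := by
      intro p
      apply hausdorffDist_le_of_mem_dist (by positivity)
      · rintro _ ⟨a, ha, rfl⟩
        obtain ⟨b, hb, h⟩ := exists_near a1 a2 b1 b2 ha
        refine ⟨_, ⟨b, hb, rfl⟩, ?_⟩
        rw [Real.dist_eq, ← ell_sub]
        rw [dist_eq_norm] at h
        exact (hD' p _).trans (mul_le_mul_of_nonneg_left h hD'0)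
      · rintro _ ⟨a, ha, rfl⟩
        obtain ⟨b, hb, h⟩ := exists_near b1 b2 a1 a2 ha
        refine ⟨_, ⟨b, hb, rfl⟩, ?_⟩
        rw [Real.dist_eq, ← ell_sub]
        rw [dist_eq_norm, hausdorffDist_comm] at h
        exact (hD' p _).trans (mul_le_mul_of_nonneg_left h hD'0)
    have hr : 0 ≤ K * (D' * δ) := by positivity
    have hN : ‖WithLp.toLp 2 (fun c => F (ell d (g c).1 '' A) (g c).2) -
      WithLp.toLp 2 (fun c => F (ell d (g c).1 '' B) (g c).2)‖ ≤ (M + 1) * (K * (D' * δ)) := by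
      rw [EuclideanSpace.norm_eq]
      apply Real.sqrt_le_iff.2 ⟨by positivity, ?_⟩
      have : ∀ i ∈ (Finset.univ : Finset (Fin M)),
          ‖(WithLp.toLp 2 (fun c => F (ell d (g c).1 '' A) (g c).2) -
          WithLp.toLp 2 (fun c => F (ell d (g c).1 '' B) (g c).2) : EuclideanSpace ℝ (Fin M)) i‖ ^ 2
          ≤ (K * (D' * δ)) ^ 2 := by
        intro i _
        apply pow_le_pow_left₀ (norm_nonneg _)
        have := ((hline (g i).1).1 (g i).2).trans (mul_le_mul_of_nonneg_left (hproj _) hK0)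
        simpa using this
      refine (Finset.sum_le_sum this).trans ?_
      rw [Finset.sum_const, Finset.card_univ, Fintype.card_fin, nsmul_eq_mul, mul_pow ((M : ℝ) + 1)]
      apply mul_le_mul_of_nonneg_right _ (by positivity)
      have : (0 : ℝ) ≤ M := by positivity
      nlinarith
    refine hN.trans ?_
    have : 0 ≤ C * K * δ := by positivity
    simp only [L]
    nlinarith
end

section
/- For every integer n ≥ 1, the n-th symmetric product ℝ^(n) is an absolute Lipschitz retract: for every metric space Y and every isometric embedding i : ℝ^(n) → Y, there exist a constant C > 0 and a C-Lipschitz map r : Y → ℝ^(n) such that r(i(A)) = A for every A ∈ ℝ^(n). -/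
open Metric

namespace KSP

abbrev SP (n : ℕ) := {A : Set ℝ // A.Finite ∧ A.Nonempty ∧ A.ncard ≤ n}

def Close (δ : ℝ) (A B : Set ℝ) : Prop :=
  (∀ a ∈ A, ∃ b ∈ B, |a - b| ≤ δ) ∧ (∀ b ∈ B, ∃ a ∈ A, |b - a| ≤ δ)

lemma Close.symm {δ : ℝ} {A B : Set ℝ} (h : Close δ A B) : Close δ B A := ⟨h.2, h.1⟩

lemma Close.mono {δ ε : ℝ} {A B : Set ℝ} (h : Close δ A B) (hd : δ ≤ ε) : Close ε A B :=
  ⟨fun a ha => let ⟨b, hb, h'⟩ := h.1 a ha; ⟨b, hb, h'.trans hd⟩,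
   fun a ha => let ⟨b, hb, h'⟩ := h.2 a ha; ⟨b, hb, h'.trans hd⟩⟩

lemma Close.trans {δ ε : ℝ} {A B C : Set ℝ} (h : Close δ A B) (h' : Close ε B C) :
    Close (δ + ε) A C := by
  constructor
  · intro a ha
    obtain ⟨b, hb, h1⟩ := h.1 a ha
    obtain ⟨c, hc, h2⟩ := h'.1 b hb
    exact ⟨c, hc, (abs_sub_le a b c).trans (by linarith)⟩
  · intro a ha
    obtain ⟨b, hb, h1⟩ := h'.2 a ha
    obtain ⟨c, hc, h2⟩ := h.2 b hb
    exact ⟨c, hc, (abs_sub_le a b c).trans (by linarith)⟩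

lemma Close.eq {A B : Set ℝ} (h : Close 0 A B) : A = B := by
  ext x
  constructor
  · intro hx
    obtain ⟨b, hb, h1⟩ := h.1 x hx
    have : x = b := by linarith [abs_le.1 h1 |>.1, abs_le.1 h1 |>.2]
    rwa [this]
  · intro hx
    obtain ⟨b, hb, h1⟩ := h.2 x hx
    have : x = b := by linarith [abs_le.1 h1 |>.1, abs_le.1 h1 |>.2]
    rwa [this]

lemma Close.hd {δ : ℝ} (hδ : 0 ≤ δ) {A B : Set ℝ} (h : Close δ A B) : hausdorffDist A B ≤ δ :=
  hausdorffDist_le_of_mem_dist hδ (fun x hx => h.1 x hx) (fun x hx => h.2 x hx)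

lemma close_of_hd {n : ℕ} (A B : SP n) {δ : ℝ} (h : hausdorffDist A.1 B.1 ≤ δ) :
    Close δ A.1 B.1 := by
  have key : ∀ A B : SP n, hausdorffDist A.1 B.1 ≤ δ → ∀ a ∈ A.1, ∃ b ∈ B.1, |a - b| ≤ δ := by
    intro A B h a ha
    obtain ⟨b, hb, h1⟩ := B.2.1.isCompact.exists_infDist_eq_dist B.2.2.1 a
    refine ⟨b, hb, ?_⟩
    rw [← Real.dist_eq, ← h1]
    refine le_trans (infDist_le_hausdorffDist_of_mem ha ?_) h
    exact hausdorffEDist_ne_top_of_nonempty_of_bounded A.2.2.1 B.2.2.1 A.2.1.isBounded B.2.1.isBounded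
  exact ⟨key A B h, key B A (by rwa [hausdorffDist_comm])⟩

/-- image of a point of the symmetric product -/
def img {n : ℕ} (A : SP n) (g : ℝ → ℝ) : SP n :=
  ⟨g '' A.1, A.2.1.image g, A.2.2.1.image g, (Set.ncard_image_le A.2.1).trans A.2.2.2⟩

/-! cluster map -/
noncomputable def pif (S : Set ℝ) (T x : ℝ) : ℝ :=
  sInf {z : ℝ | ∀ u, z ≤ u → u ≤ x → ∃ s ∈ S, |u - s| ≤ 2 * T}

lemma pif_eq_aux {S : Set ℝ} {T x x' : ℝ} (hx : ∃ s ∈ S, |x - s| ≤ T) (hle : x ≤ x')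
    (h : |x - x'| ≤ T) : pif S T x = pif S T x' := by
  unfold pif
  congr 1
  ext z
  constructor
  · intro hz u hu hu'
    by_cases hc : u ≤ x
    · exact hz u hu hc
    · obtain ⟨s, hs, h1⟩ := hx
      refine ⟨s, hs, ?_⟩
      rw [abs_le] at *
      constructor <;> linarith
  · intro hz u hu hu'
    exact hz u hu (hu'.trans hle)

lemma pif_eq {S : Set ℝ} {T x x' : ℝ} (hx : ∃ s ∈ S, |x - s| ≤ T) (hx' : ∃ s ∈ S, |x' - s| ≤ T)
    (h : |x - x'| ≤ T) : pif S T x = pif S T x' := by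
  rcases le_total x x' with hle | hle
  · exact pif_eq_aux hx hle h
  · exact (pif_eq_aux hx' hle (by rwa [abs_sub_comm])).symm

lemma pif_near {S : Set ℝ} (hS : S.Finite) {n : ℕ} (hn : S.ncard ≤ n) {T x : ℝ} (hT : 0 ≤ T)
    (hx : ∃ s ∈ S, |x - s| ≤ T) : |pif S T x - x| ≤ 4 * n * T := by
  have hxm : x ∈ {z : ℝ | ∀ u, z ≤ u → u ≤ x → ∃ s ∈ S, |u - s| ≤ 2 * T} := by
    intro u hu hu'
    obtain ⟨s, hs, h1⟩ := hx
    have : u = x := le_antisymm hu' hu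
    exact ⟨s, hs, by rw [this]; linarith⟩
  have hlow : ∀ z ∈ {z : ℝ | ∀ u, z ≤ u → u ≤ x → ∃ s ∈ S, |u - s| ≤ 2 * T},
      x - 4 * n * T ≤ z := by
    intro z hz
    have hsub : Set.Icc z x ⊆ ⋃ s ∈ hS.toFinset, Set.Icc (s - 2 * T) (s + 2 * T) := by
      intro u hu
      obtain ⟨s, hs, h1⟩ := hz u hu.1 hu.2
      rw [abs_le] at h1
      simp only [Set.mem_iUnion]
      exact ⟨s, by simpa using hs, by linarith, by linarith⟩
    have h1 := (MeasureTheory.measure_mono (μ := MeasureTheory.volume) hsub).trans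
      (MeasureTheory.measure_biUnion_finset_le _ _)
    simp only [Real.volume_Icc] at h1
    have h2 : ∀ s : ℝ, s + 2 * T - (s - 2 * T) = 4 * T := fun s => by ring
    simp only [h2, Finset.sum_const, nsmul_eq_mul] at h1
    rw [← ENNReal.ofReal_natCast, ← ENNReal.ofReal_mul (by positivity),
      ENNReal.ofReal_le_ofReal_iff (by positivity)] at h1
    have h3 : (hS.toFinset.card : ℝ) ≤ n := by
      rw [← Set.ncard_eq_toFinset_card S hS]; exact_mod_cast hn
    nlinarith
  have h1 : x - 4 * n * T ≤ pif S T x := le_csInf ⟨x, hxm⟩ hlow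
  have h2 : pif S T x ≤ x := csInf_le ⟨_, hlow⟩ hxm
  rw [abs_le]
  constructor <;> nlinarith [show 0 ≤ 4 * n * T by positivity]

/-! grid -/
def G (n : ℕ) (w : ℝ) (j : ℕ) : Set (SP n) :=
  {A | ∀ a ∈ A.1, ∀ z : ℤ, w / 2 ≤ |a - (j * w + (n + 1) * w * z)|}

lemma G_nonempty (n : ℕ) (hn : 1 ≤ n) (w : ℝ) (hw : 0 < w) (j : ℕ) : (G n w j).Nonempty := by
  refine ⟨⟨{j * w + (n + 1) * w / 2}, by simp, by simp, by simpa using hn⟩, ?_⟩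
  intro a ha z
  simp only [Set.mem_singleton_iff] at ha
  subst ha
  have : (j * w + (n + 1) * w / 2 - (j * w + (n + 1) * w * z) : ℝ) = (n+1) * w * (1/2 - z) := by ring
  rw [this, abs_mul, abs_of_pos (by positivity)]
  have h1 : (1/2 : ℝ) ≤ |1/2 - (z:ℝ)| := by
    rcases le_or_gt z 0 with h | h
    · have : (z:ℝ) ≤ 0 := by exact_mod_cast h
      exact le_trans (by linarith) (le_abs_self _)
    · have : (1:ℝ) ≤ z := by exact_mod_cast h
      exact le_trans (by linarith) (neg_le_abs _)
  have h2 : (0:ℝ) ≤ n := by positivity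
  have h3 : w ≤ (n+1) * w := by nlinarith
  calc w / 2 = w * (1/2) := by ring
    _ ≤ (n+1) * w * |1/2 - (z:ℝ)| := by gcongr

lemma exists_G (n : ℕ) (w : ℝ) (hw : 0 < w) (A : SP n) : ∃ j < n + 1, A ∈ G n w j := by
  classical
  let f : ℝ → ℕ := fun a => (round (a / w) % ((n : ℤ) + 1)).toNat
  have hc : (A.2.1.toFinset.image f).card < (Finset.range (n+1)).card := by
    rw [Finset.card_range]
    refine lt_of_le_of_lt Finset.card_image_le ?_
    rw [← Set.ncard_eq_toFinset_card A.1 A.2.1]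
    have := A.2.2.2
    omega
  obtain ⟨j, hj, hj'⟩ := Finset.exists_mem_notMem_of_card_lt_card hc
  refine ⟨j, by simpa using hj, ?_⟩
  intro a ha z
  by_contra hlt
  push Not at hlt
  apply hj'
  rw [Finset.mem_image]
  refine ⟨a, by simpa using ha, ?_⟩
  have hr : round (a / w) = j + (n+1) * z := by
    rw [round_eq, Int.floor_eq_iff]
    rw [abs_lt] at hlt
    push_cast
    have e : a = a / w * w := by field_simp
    rw [e] at hlt
    constructor
    · have : ((j:ℝ) + (n+1) * z) * w ≤ (a / w + 1/2) * w := by linarith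
      exact le_of_mul_le_mul_right this hw
    · have : (a / w + 1/2) * w < ((j:ℝ) + (n+1) * z + 1) * w := by linarith
      exact lt_of_mul_lt_mul_right this hw.le
  have hj2 : j < n + 1 := by simpa using hj
  simp only [f, hr]
  rw [Int.add_mul_emod_self_left, Int.emod_eq_of_lt (by positivity) (by exact_mod_cast hj2)]
  simp

noncomputable def snap (n : ℕ) (w : ℝ) (j : ℕ) (b : ℝ) : ℝ :=
  j * w + (n + 1) * w * (⌊(b - j * w) / ((n + 1) * w)⌋ : ℤ)

lemma snap_near (n : ℕ) (w : ℝ) (hw : 0 < w) (j : ℕ) (b : ℝ) :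
    |b - snap n w j b| ≤ (n + 1) * w := by
  unfold snap
  have hp : 0 < (n + 1) * w := by positivity
  set c := (b - j * w) / ((n + 1) * w) with hc
  have e : b = j * w + (n+1) * w * c := by rw [hc]; field_simp; ring
  have h1 := Int.floor_le c
  have h2 := Int.lt_floor_add_one c
  rw [abs_le]
  constructor <;> nlinarith

lemma snap_eq_aux (n : ℕ) (w : ℝ) (hw : 0 < w) (j : ℕ) (a b : ℝ) 
    (ha : ∀ z : ℤ, w / 2 ≤ |a - (j * w + (n + 1) * w * z)|)
    (hb : ∀ z : ℤ, w / 2 ≤ |b - (j * w + (n + 1) * w * z)|)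
    (h : |a - b| < w) : ¬ (⌊(a - j * w) / ((n + 1) * w)⌋ < ⌊(b - j * w) / ((n + 1) * w)⌋) := by
  intro hlt
  have hp : 0 < (n + 1) * w := by positivity
  set z := ⌊(b - j * w) / ((n + 1) * w)⌋ with hz
  have h1 : (z:ℝ) ≤ (b - j * w) / ((n + 1) * w) := Int.floor_le _
  have h2 : (a - j * w) / ((n + 1) * w) < z := Int.floor_lt.1 hlt
  rw [le_div_iff₀ hp] at h1
  rw [div_lt_iff₀ hp] at h2
  have h3 := ha z
  have h4 := hb z
  rw [abs_of_nonneg (by linarith)] at h4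
  rw [abs_of_neg (by linarith)] at h3
  rw [abs_lt] at h
  linarith

lemma snap_eq (n : ℕ) (w : ℝ) (hw : 0 < w) (j : ℕ) (A B : SP n) (hA : A ∈ G n w j)
    (hB : B ∈ G n w j) {δ : ℝ} (hδ : δ < w) (h : Close δ A.1 B.1) :
    snap n w j '' A.1 = snap n w j '' B.1 := by
  have key : ∀ A ∈ G n w j, ∀ B ∈ G n w j, Close δ A.1 B.1 →
      snap n w j '' A.1 ⊆ snap n w j '' B.1 := by
    rintro A hA B hB h _ ⟨a, ha, rfl⟩
    obtain ⟨b, hb, hab⟩ := h.1 a ha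
    refine ⟨b, hb, ?_⟩
    unfold snap
    have h1 := snap_eq_aux n w hw j a b (hA a ha) (hB b hb) (by linarith)
    have h2 := snap_eq_aux n w hw j b a (hB b hb) (hA a ha) (by rw [abs_sub_comm]; linarith)
    rw [le_antisymm (not_lt.1 h1) (not_lt.1 h2)]
  exact Set.Subset.antisymm (key A hA B hB h) (key B hB A hA h.symm)

/-! scales -/
noncomputable def Q (p : ℕ) (r : ℝ) : ℝ := 4 ^ p * (16:ℝ) ^ (Int.log 16 (4 * r / 4 ^ p))

lemma Q_pos (p : ℕ) (r : ℝ) : 0 < Q p r := by unfold Q; positivity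

lemma Q_eq (p : ℕ) (r : ℝ) (z : ℤ) (h1 : 4 ^ p * (16:ℝ) ^ z / 4 ≤ r)
    (h2 : r < 4 * (4 ^ p * (16:ℝ) ^ z)) : Q p r = 4 ^ p * (16:ℝ) ^ z := by
  unfold Q
  have h4 : (0:ℝ) < 4 ^ p := by positivity
  have hz : (0:ℝ) < 16 ^ z := by positivity
  have hr : 0 < r := lt_of_lt_of_le (by positivity) h1
  have : Int.log 16 (4 * r / 4 ^ p) = z := by
    apply le_antisymm
    · have : Int.log 16 (4 * r / 4 ^ p) < z + 1 := by
        rw [← Int.lt_zpow_iff_log_lt (by norm_num) (by positivity)]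
        push_cast
        rw [zpow_add₀ (by norm_num), div_lt_iff₀ h4]
        norm_num; linarith
      omega
    · rw [← Int.zpow_le_iff_le_log (by norm_num) (by positivity)]
      push_cast
      rw [le_div_iff₀ h4]; linarith
  rw [this]

lemma Q_stable (p : ℕ) (r r' : ℝ) (h1 : Q p r / 4 ≤ r') (h2 : r' < 4 * Q p r) :
    Q p r' = Q p r := by
  exact Q_eq p r' _ h1 h2

lemma exists_scale (r : ℝ) (hr : 0 < r) : ∃ p < 2, ∃ z : ℤ,
    4 ^ p * (16:ℝ) ^ z / 2 ≤ r ∧ r ≤ 2 * (4 ^ p * (16:ℝ) ^ z) := by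
  obtain ⟨k, hk1, hk2⟩ := exists_mem_Ico_zpow (x := 2 * r) (y := (4:ℝ)) (by linarith) (by norm_num)
  rw [zpow_add₀ (by norm_num)] at hk2
  norm_num at hk2
  have e : ∀ z : ℤ, (16:ℝ) ^ z = 4 ^ (2 * z) := by
    intro z; rw [zpow_mul]; norm_num
  rcases Int.even_or_odd' k with ⟨z, rfl | rfl⟩
  · refine ⟨0, by norm_num, z, ?_, ?_⟩ <;> rw [e] <;> norm_num <;> linarith
  · rw [zpow_add₀ (by norm_num)] at hk1 hk2
    refine ⟨1, by norm_num, z, ?_, ?_⟩ <;> rw [e] <;> norm_num at * <;> linarith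

/-! completeness -/
lemma exists_fun {n : ℕ} (A : SP n) : ∃ f : Fin n → ℝ, Set.range f = A.1 := by
  obtain ⟨hf, hne, hc⟩ := A.2
  have : Nonempty A.1 := hne.to_subtype
  have : Fintype A.1 := hf.fintype
  have hc' : Fintype.card A.1 ≤ Fintype.card (Fin n) := by
    rw [Fintype.card_fin, ← Nat.card_eq_fintype_card]; exact hc
  obtain ⟨e⟩ := Function.Embedding.nonempty_of_card_le hc'
  refine ⟨fun k => (Function.invFun e k : A.1), ?_⟩
  have := Function.invFun_surjective e.injective
  ext x
  constructor
  · rintro ⟨k, rfl⟩; exact Subtype.coe_prop _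
  · intro hx
    obtain ⟨k, hk⟩ := this ⟨x, hx⟩
    exact ⟨k, by simp [hk]⟩

lemma mem_range_of_infDist {n : ℕ} (hn : 1 ≤ n) {Y : Type*} [MetricSpace Y] (i : SP n → Y)
    (hi : ∀ A B : SP n, dist (i A) (i B) = hausdorffDist A.1 B.1) (y : Y)
    (hy : infDist y (Set.range i) = 0) : ∃ A, i A = y := by
  have hne : (Set.range i).Nonempty :=
    ⟨_, ⟨⟨{0}, by simp, by simp, by simpa using hn⟩, rfl⟩⟩
  have h1 : ∀ k : ℕ, ∃ A : SP n, dist y (i A) < 1 / ((k:ℝ) + 1) := by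
    intro k
    obtain ⟨_, ⟨A, rfl⟩, h⟩ := (infDist_lt_iff hne).1 (lt_of_eq_of_lt hy (Nat.one_div_pos_of_nat (α := ℝ) (n := k)))
    exact ⟨A, h⟩
  choose A hA using h1
  choose f hf using fun k => exists_fun (A k)
  have hbd : Bornology.IsBounded (Set.range f) := by
    obtain ⟨M, hM⟩ := (A 0).2.1.isBounded.exists_norm_le
    rw [isBounded_iff_forall_norm_le]
    refine ⟨M + 2, ?_⟩
    rintro _ ⟨k, rfl⟩
    obtain ⟨a0, ha0⟩ := (A 0).2.2.1
    have hM0 : 0 ≤ M := (norm_nonneg a0).trans (hM a0 ha0)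
    rw [pi_norm_le_iff_of_nonneg (by linarith)]
    intro l
    have hd : hausdorffDist (A k).1 (A 0).1 ≤ 2 := by
      rw [← hi]
      have h1 := hA k
      have h2 := hA 0
      have h3 : 1 / ((k:ℝ) + 1) ≤ 1 := by
        rw [div_le_one (by positivity)]; linarith [Nat.cast_nonneg (α := ℝ) k]
      have h4 := dist_triangle_left (i (A k)) (i (A 0)) y
      norm_num at h2
      linarith
    obtain ⟨b, hb, hb'⟩ := (close_of_hd _ _ hd).1 (f k l) (by rw [← hf k]; exact ⟨l, rfl⟩)
    have := hM b hb
    rw [Real.norm_eq_abs] at *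
    have := abs_sub_abs_le_abs_sub (f k l) b
    linarith
  obtain ⟨g, -, φ, hφ, hlim⟩ := tendsto_subseq_of_bounded hbd (fun k => ⟨k, rfl⟩)
  have : Nonempty (Fin n) := ⟨⟨0, hn⟩⟩
  let B : SP n := ⟨Set.range g, Set.finite_range g, Set.range_nonempty g, by
    rw [← Set.image_univ]
    refine (Set.ncard_image_le Set.finite_univ).trans ?_
    simp [Set.ncard_univ]⟩
  refine ⟨B, ?_⟩
  have hlim2 : Filter.Tendsto (fun k => i (A (φ k))) Filter.atTop (nhds (i B)) := by
    rw [tendsto_iff_dist_tendsto_zero] at hlim ⊢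
    refine squeeze_zero (fun _ => dist_nonneg) (fun k => ?_) hlim
    rw [hi]
    apply Close.hd dist_nonneg
    rw [← hf]
    constructor
    · rintro _ ⟨l, rfl⟩
      exact ⟨g l, ⟨l, rfl⟩, by rw [← Real.dist_eq]; exact dist_le_pi_dist (f (φ k)) g l⟩
    · rintro _ ⟨l, rfl⟩
      exact ⟨_, ⟨l, rfl⟩, by rw [← Real.dist_eq, dist_comm]; exact dist_le_pi_dist (f (φ k)) g l⟩
  have hlim3 : Filter.Tendsto (fun k => i (A k)) Filter.atTop (nhds y) := by
    rw [tendsto_iff_dist_tendsto_zero]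
    refine squeeze_zero (fun _ => dist_nonneg) (fun k => ?_) (tendsto_one_div_add_atTop_nhds_zero_nat (𝕜 := ℝ))
    rw [dist_comm]; exact (hA k).le
  exact tendsto_nhds_unique hlim2 (hlim3.comp hφ.tendsto_atTop)


lemma clamp_lip {a b c a' b' c' δ : ℝ} (h1 : |a - a'| ≤ δ) (h2 : |b - b'| ≤ δ) (h3 : |c - c'| ≤ δ) :
    |max 0 (min 1 (min (min a b) c)) - max 0 (min 1 (min (min a' b') c'))| ≤ δ := by
  have hδ : 0 ≤ δ := (abs_nonneg _).trans h1
  have e1 : |min a b - min a' b'| ≤ δ :=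
    (abs_min_sub_min_le_max a b a' b').trans (max_le h1 h2)
  have e2 : |min (min a b) c - min (min a' b') c'| ≤ δ :=
    (abs_min_sub_min_le_max _ _ _ _).trans (max_le e1 h3)
  have e3 : |min 1 (min (min a b) c) - min 1 (min (min a' b') c')| ≤ δ :=
    (abs_min_sub_min_le_max _ _ _ _).trans (max_le (by simpa using hδ) e2)
  exact (abs_max_sub_max_le_max _ _ _ _).trans (max_le (by simpa using hδ) e3)

def Full {n : ℕ} {Y : Type*} [MetricSpace Y] (i : SP n → Y) (p j : ℕ) (y : Y) : Prop :=
  ∃ z : ℤ, 4 ^ p * (16:ℝ) ^ z / 2 ≤ infDist y (Set.range i) ∧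
    infDist y (Set.range i) ≤ 2 * (4 ^ p * (16:ℝ) ^ z) ∧
    infDist y (i '' G n (30 * (4 ^ p * (16:ℝ) ^ z)) j) ≤ 2 * infDist y (Set.range i)

lemma step {n : ℕ} (hn : 1 ≤ n) {Y : Type*} [MetricSpace Y] (i : SP n → Y)
    (hi : ∀ A B : SP n, dist (i A) (i B) = hausdorffDist A.1 B.1) (a : Y → SP n)
    (ρ : Y → ℝ) (hρ : ρ = fun y => infDist y (Set.range i))
    (ha : ∀ y, dist y (i (a y)) ≤ 2 * ρ y) (p j : ℕ) (R : ℝ) (hR : 0 ≤ R) :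
    ∃ K L : ℝ, 0 ≤ K ∧ 0 ≤ L ∧ ∃ (t : Y → ℝ) (π : Y → ℝ → ℝ),
      (∀ y, 0 ≤ t y ∧ t y ≤ 1) ∧
      (∀ y, 0 < t y → ∀ x, (∃ b ∈ (a y).1, |x - b| ≤ R * ρ y) → |π y x - x| ≤ K * ρ y) ∧
      (∀ y, 0 < t y → ∀ x x', (∃ b ∈ (a y).1, |x - b| ≤ R * ρ y) →
        (∃ b ∈ (a y).1, |x' - b| ≤ R * ρ y) → |x - x'| ≤ R * ρ y → π y x = π y x') ∧
      (∀ y y', dist y y' ≤ ρ y / 100 → |t y - t y'| * ρ y ≤ L * dist y y') ∧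
      (∀ y y', dist y y' ≤ ρ y / 100 → 0 < t y → 0 < t y' → π y = π y') ∧
      (∀ y y', Full i p j y → dist y y' ≤ ρ y / 100 → t y = 1 ∧ t y' = 1) := by
  have hρ0 : ∀ y, 0 ≤ ρ y := fun y => by rw [hρ]; exact infDist_nonneg
  have hρL : ∀ y y', |ρ y - ρ y'| ≤ dist y y' := fun y y' => by
    have h1 := infDist_le_infDist_add_dist (s := Set.range i) (x := y) (y := y')
    have h2 := infDist_le_infDist_add_dist (s := Set.range i) (x := y') (y := y)
    rw [dist_comm y' y] at h2
    rw [hρ, abs_le]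
    constructor <;> simp only <;> linarith
  let q : Y → ℝ := fun y => Q p (ρ y)
  have hq : ∀ y, 0 < q y := fun y => Q_pos _ _
  let D : ℝ → Y → ℝ := fun s y => infDist y (i '' G n (30 * s) j)
  have hDL : ∀ s y y', |D s y - D s y'| ≤ dist y y' := fun s y y' => by
    have h1 := infDist_le_infDist_add_dist (s := i '' G n (30 * s) j) (x := y) (y := y')
    have h2 := infDist_le_infDist_add_dist (s := i '' G n (30 * s) j) (x := y') (y := y)
    rw [dist_comm y' y] at h2
    rw [abs_le]
    constructor <;> simp only [D] <;> linarith
  let t : Y → ℝ := fun y => max 0 (min 1 (min (min ((ρ y / q y - 0.3) * 30)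
    ((3.3 - ρ y / q y) * 4)) (2 - D (q y) y / (7 * q y))))
  have htpos : ∀ y, 0 < t y → 0.3 * q y < ρ y ∧ ρ y < 3.3 * q y ∧ D (q y) y < 14 * q y := by
    intro y h
    have hqy := hq y
    simp only [t, lt_max_iff, lt_irrefl, false_or, lt_min_iff] at h
    obtain ⟨-, ⟨h1, h2⟩, h3⟩ := h
    refine ⟨?_, ?_, ?_⟩
    · rw [← lt_div_iff₀ hqy]; linarith
    · rw [← div_lt_iff₀ hqy]; linarith
    · have : D (q y) y / (7 * q y) < 2 := by linarith
      rw [div_lt_iff₀ (by positivity)] at this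
      linarith
  have hsame : ∀ y y', dist y y' ≤ ρ y / 100 → (0 < t y ∨ 0 < t y') → q y = q y' := by
    intro y y' hd hor
    have h1 := abs_le.1 ((hρL y y').trans hd)
    rcases hor with h | h
    · obtain ⟨h2, h3, -⟩ := htpos y h
      have := hq y
      exact (Q_stable p (ρ y) (ρ y') (by simp only [q] at *; linarith) (by simp only [q] at *; linarith)).symm
    · obtain ⟨h2, h3, -⟩ := htpos y' h
      have := hq y'
      exact (Q_stable p (ρ y') (ρ y) (by simp only [q] at *; linarith) (by simp only [q] at *; linarith))
  have ht01 : ∀ y, 0 ≤ t y ∧ t y ≤ 1 := fun y =>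
    ⟨le_max_left _ _, max_le (by norm_num) (min_le_left _ _)⟩
  have hB : ∀ y, ∃ B : SP n, 0 < t y → B ∈ G n (30 * q y) j ∧ dist y (i B) < 14 * q y := by
    intro y
    by_cases h : 0 < t y
    · obtain ⟨-, -, h3⟩ := htpos y h
      have hne : (i '' G n (30 * q y) j).Nonempty :=
        (G_nonempty n hn _ (by have := hq y; positivity) j).image i
      obtain ⟨_, ⟨B, hB, rfl⟩, h4⟩ := (infDist_lt_iff hne).1 h3
      exact ⟨B, fun _ => ⟨hB, h4⟩⟩
    · exact ⟨a y, fun h' => absurd h' h⟩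
  choose B hB using hB
  let c : ℝ := 3.3 * R + 21 + 30 * (n + 1)
  have hc : 0 ≤ c := by positivity
  let S : Y → Set ℝ := fun y => snap n (30 * q y) j '' (B y).1
  have hSf : ∀ y, (S y).Finite := fun y => (B y).2.1.image _
  have hSc : ∀ y, (S y).ncard ≤ n := fun y => (Set.ncard_image_le (B y).2.1).trans (B y).2.2.2
  have hnear : ∀ y, 0 < t y → ∀ x, (∃ b ∈ (a y).1, |x - b| ≤ R * ρ y) →
      ∃ s ∈ S y, |x - s| ≤ c * q y := by
    rintro y h x ⟨b, hb, hxb⟩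
    obtain ⟨h1, h2, -⟩ := htpos y h
    have hqy := hq y
    obtain ⟨h3, h4⟩ := hB y h
    have h5 : hausdorffDist (a y).1 (B y).1 ≤ 21 * q y := by
      rw [← hi]
      have := dist_triangle_left (i (a y)) (i (B y)) y
      have := ha y
      linarith
    obtain ⟨b', hb', h6⟩ := (close_of_hd _ _ h5).1 b hb
    refine ⟨_, ⟨b', hb', rfl⟩, ?_⟩
    have h7 := snap_near n (30 * q y) (by positivity) j b'
    have h8 := abs_sub_le x b (snap n (30 * q y) j b')
    have h9 := abs_sub_le b b' (snap n (30 * q y) j b')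
    have h10 : R * ρ y ≤ R * (3.3 * q y) := by gcongr
    simp only [c]
    linarith
  refine ⟨4 * n * (c * 4), 120, by positivity, by norm_num, t, fun y => pif (S y) (c * q y), ht01,
    ?_, ?_, ?_, ?_, ?_⟩
  · intro y h x hx
    have hqy := hq y
    have h1 := pif_near (hSf y) (hSc y) (T := c * q y) (by positivity) (hnear y h x hx)
    refine h1.trans ?_
    obtain ⟨h2, -, -⟩ := htpos y h
    have : q y ≤ 4 * ρ y := by linarith
    calc 4 * n * (c * q y) ≤ 4 * n * (c * (4 * ρ y)) := by gcongr
      _ = _ := by ring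
  · intro y h x x' hx hx' hxx
    obtain ⟨h1, h2, -⟩ := htpos y h
    have hqy := hq y
    refine pif_eq (hnear y h x hx) (hnear y h x' hx') (hxx.trans ?_)
    have h10 : R * ρ y ≤ R * (3.3 * q y) := by gcongr
    have : 0 ≤ (21 + 30 * ((n:ℝ) + 1)) * q y := by positivity
    simp only [c]
    linarith
  · intro y y' hd
    by_cases hor : 0 < t y ∨ 0 < t y'
    · have hqq := hsame y y' hd hor
      have hqy := hq y
      have h1 := hρL y y'
      have h2 := hDL (q y) y y'
      have h3 : ρ y ≤ 4 * q y := by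
        have h1 := abs_le.1 ((hρL y y').trans hd)
        rcases hor with h | h
        · linarith [(htpos y h).2.1]
        · linarith [(htpos y' h).2.1]
      have key : |t y - t y'| ≤ 30 * dist y y' / q y := by
        simp only [t]
        rw [← hqq]
        apply clamp_lip
        · have : (ρ y / q y - 0.3) * 30 - (ρ y' / q y - 0.3) * 30 = 30 * (ρ y - ρ y') / q y := by ring
          rw [this, abs_div, abs_mul, abs_of_pos hqy, abs_of_pos (by norm_num : (0:ℝ) < 30)]
          gcongr
        · have : (3.3 - ρ y / q y) * 4 - (3.3 - ρ y' / q y) * 4 = (-4) * (ρ y - ρ y') / q y := by ring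
          rw [this, abs_div, abs_mul, abs_of_pos hqy]
          have : |(-4:ℝ)| = 4 := by norm_num
          rw [this]
          gcongr
          norm_num
        · have : 2 - D (q y) y / (7 * q y) - (2 - D (q y) y' / (7 * q y))
            = (-1/7) * (D (q y) y - D (q y) y') / q y := by field_simp; ring
          rw [this, abs_div, abs_mul, abs_of_pos hqy]
          have : |(-1/7:ℝ)| = 1/7 := by norm_num [abs_div]
          rw [this]
          gcongr
          norm_num
      calc |t y - t y'| * ρ y ≤ 30 * dist y y' / q y * (4 * q y) := by
            gcongr
            exact hρ0 y
        _ = 120 * dist y y' := by field_simp; ring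
    · push Not at hor
      have e1 : t y = 0 := le_antisymm hor.1 (ht01 y).1
      have e2 : t y' = 0 := le_antisymm hor.2 (ht01 y').1
      rw [e1, e2]; simp
  · intro y y' hd h h'
    have hqq := hsame y y' hd (Or.inl h)
    obtain ⟨h1, h2, -⟩ := htpos y h
    have hqy := hq y
    obtain ⟨h3, h4⟩ := hB y h
    obtain ⟨h5, h6⟩ := hB y' h'
    rw [← hqq] at h5 h6
    have h7 : hausdorffDist (B y).1 (B y').1 ≤ 29 * q y := by
      rw [← hi]
      have e1 := dist_triangle_left (i (B y)) (i (B y')) y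
      have e2 := dist_triangle y y' (i (B y'))
      linarith
    have : S y = S y' := by
      simp only [S]
      rw [← hqq]
      exact snap_eq n _ (by positivity) j _ _ h3 h5 (by linarith) (close_of_hd _ _ h7)
    show pif (S y) (c * q y) = pif (S y') (c * q y')
    rw [this, hqq]
  · rintro y y' ⟨z, h1, h2, h3⟩ hd
    have hpos : (0:ℝ) < 4 ^ p * (16:ℝ) ^ z := by positivity
    have hr : ρ y = infDist y (Set.range i) := by rw [hρ]
    rw [← hr] at h1 h2 h3
    have h4 := abs_le.1 ((hρL y y').trans hd)
    have e1 : q y = 4 ^ p * (16:ℝ) ^ z := Q_eq p _ z (by linarith) (by linarith)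
    have e2 : q y' = 4 ^ p * (16:ℝ) ^ z := Q_eq p _ z (by linarith) (by linarith)
    have h5 := abs_le.1 ((hDL (q y) y y').trans hd)
    have h6 : D (q y) y ≤ 2 * ρ y := by simp only [D]; rw [e1]; exact h3
    have key : ∀ u, q u = 4 ^ p * (16:ℝ) ^ z → 0.4 * q u ≤ ρ u → ρ u ≤ 2.5 * q u →
        D (q u) u ≤ 7 * q u → t u = 1 := by
      intro u hu h1 h2 h3
      have hqu := hq u
      have g1 : 0.4 ≤ ρ u / q u := by rw [le_div_iff₀ hqu]; linarith
      have g2 : ρ u / q u ≤ 2.5 := by rw [div_le_iff₀ hqu]; linarith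
      have g3 : D (q u) u / (7 * q u) ≤ 1 := by rw [div_le_one (by positivity)]; linarith
      simp only [t]
      rw [min_eq_left, max_eq_right (by norm_num)]
      refine le_min (le_min ?_ ?_) ?_ <;> linarith
    refine ⟨key y e1 ?_ ?_ ?_, key y' e2 ?_ ?_ ?_⟩
    · rw [e1]; linarith
    · rw [e1]; linarith
    · rw [e1] at h6 ⊢; linarith
    · rw [e2]; linarith
    · rw [e2]; linarith
    · rw [e2, ← e1]; rw [← e1] at h2; linarith

lemma iter {n : ℕ} (hn : 1 ≤ n) {Y : Type*} [MetricSpace Y] (i : SP n → Y)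
    (hi : ∀ A B : SP n, dist (i A) (i B) = hausdorffDist A.1 B.1) (a : Y → SP n)
    (ρ : Y → ℝ) (hρ : ρ = fun y => infDist y (Set.range i))
    (ha : ∀ y, dist y (i (a y)) ≤ 2 * ρ y) (m : ℕ) :
    ∃ E Λ : ℝ, 0 ≤ E ∧ 0 ≤ Λ ∧ ∃ Ψ : Y → SP n,
      (∀ y, Close (E * ρ y) (Ψ y).1 (a y).1) ∧
      (∀ y y', (∃ c < m, Full i (c % 2) (c / 2) y) → dist y y' ≤ ρ y / 100 →
        Close (Λ * dist y y') (Ψ y).1 (Ψ y').1) := by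
  have hρ0 : ∀ y, 0 ≤ ρ y := fun y => by rw [hρ]; exact infDist_nonneg
  have hρL : ∀ y y', |ρ y - ρ y'| ≤ dist y y' := fun y y' => by
    have h1 := infDist_le_infDist_add_dist (s := Set.range i) (x := y) (y := y')
    have h2 := infDist_le_infDist_add_dist (s := Set.range i) (x := y') (y := y)
    rw [dist_comm y' y] at h2
    rw [hρ, abs_le]
    constructor <;> simp only <;> linarith
  induction m with
  | zero =>
    refine ⟨0, 0, le_rfl, le_rfl, a, ?_, ?_⟩
    · intro y
      exact ⟨fun b hb => ⟨b, hb, by simp⟩, fun b hb => ⟨b, hb, by simp⟩⟩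
    · rintro y y' ⟨c, hc, -⟩
      omega
  | succ m ih =>
    obtain ⟨E, Λ, hE, hΛ, Ψ, h1, h2⟩ := ih
    let R : ℝ := 4 * E + 10 + Λ
    have hR : 0 ≤ R := by positivity
    obtain ⟨K, L, hK, hL, t, π, ht, hπ1, hπ2, htL, hππ, hfull⟩ :=
      step hn i hi a ρ hρ ha (m % 2) (m / 2) R hR
    let g : Y → ℝ → ℝ := fun y x => x + t y * (π y x - x)
    have hnear : ∀ y, ∀ x ∈ (Ψ y).1, ∃ b ∈ (a y).1, |x - b| ≤ R * ρ y := by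
      intro y x hx
      obtain ⟨b, hb, h⟩ := (h1 y).1 x hx
      refine ⟨b, hb, h.trans ?_⟩
      have := hρ0 y
      gcongr
      simp only [R]; linarith
    have haa : ∀ y y', dist y y' ≤ ρ y / 100 → Close (5 * ρ y) (a y).1 (a y').1 := by
      intro y y' hd
      apply close_of_hd
      rw [← hi]
      have e0 := abs_le.1 ((hρL y y').trans hd)
      have e1 := dist_triangle_left (i (a y)) (i (a y')) y
      have e2 := dist_triangle y y' (i (a y'))
      have := ha y
      have := ha y'
      have := hρ0 y
      linarith
    have hnear' : ∀ y y', dist y y' ≤ ρ y / 100 → ∀ x ∈ (Ψ y').1,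
        ∃ b ∈ (a y).1, |x - b| ≤ R * ρ y := by
      intro y y' hd x hx
      obtain ⟨b, hb, h⟩ := ((h1 y').trans (haa y y' hd).symm).1 x hx
      refine ⟨b, hb, h.trans ?_⟩
      have := hρ0 y
      have e0 := abs_le.1 ((hρL y y').trans hd)
      have : E * ρ y' ≤ E * (2 * ρ y) := by gcongr; linarith
      simp only [R]
      nlinarith [mul_nonneg hE (hρ0 y), mul_nonneg hΛ (hρ0 y)]
    have hΨΨ : ∀ y y', dist y y' ≤ ρ y / 100 → Close (R * ρ y) (Ψ y).1 (Ψ y').1 := by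
      intro y y' hd
      refine (((h1 y).trans (haa y y' hd)).trans (h1 y').symm).mono ?_
      have := hρ0 y
      have e0 := abs_le.1 ((hρL y y').trans hd)
      have : E * ρ y' ≤ E * (2 * ρ y) := by gcongr; linarith
      simp only [R]
      nlinarith [mul_nonneg hE (hρ0 y), mul_nonneg hΛ (hρ0 y)]
    have hmove : ∀ y, ∀ x ∈ (Ψ y).1, t y * |π y x - x| ≤ t y * (K * ρ y) := by
      intro y x hx
      rcases (ht y).1.eq_or_lt with h | h
      · rw [← h]; simp
      · have := hπ1 y h x (hnear y x hx)
        gcongr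
    have hpair : ∀ y y', dist y y' ≤ ρ y / 100 → ∀ x ∈ (Ψ y).1, ∀ x' ∈ (Ψ y').1,
        |x - x'| ≤ Λ * dist y y' → |g y x - g y' x'| ≤ (Λ + 2 * L * K) * dist y y' := by
      intro y y' hd x hx x' hx' hxx
      have hd0 : 0 ≤ dist y y' := dist_nonneg
      have e0 := abs_le.1 ((hρL y y').trans hd)
      have hLd := htL y y' hd
      have hy0 := hρ0 y
      have hnn : 0 ≤ K * (L * dist y y') := by positivity
      have hfin : |t y - t y'| * (K * ρ y) ≤ K * (L * dist y y') := by
        calc |t y - t y'| * (K * ρ y) = K * (|t y - t y'| * ρ y) := by ring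
          _ ≤ _ := by gcongr
      rcases (ht y').1.eq_or_lt with h' | h'
      · have e : g y x - g y' x' = (x - x') + t y * (π y x - x) := by
          simp only [g]; rw [← h']; ring
        rw [e]
        refine (abs_add_le _ _).trans ?_
        rw [abs_mul, abs_of_nonneg (ht y).1]
        have := hmove y x hx
        rw [← h', sub_zero, abs_of_nonneg (ht y).1] at hfin
        linarith
      · rcases (ht y).1.eq_or_lt with h | h
        · have e : g y x - g y' x' = (x - x') - t y' * (π y' x' - x') := by
            simp only [g]; rw [← h]; ring
          rw [e]
          refine (abs_sub _ _).trans ?_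
          rw [abs_mul, abs_of_nonneg (ht y').1]
          have h3 := hmove y' x' hx'
          rw [← h, zero_sub, abs_neg, abs_of_nonneg (ht y').1] at hfin
          have h4 : t y' * (K * ρ y') ≤ t y' * (K * (2 * ρ y)) := by
            have := (ht y').1
            gcongr
            linarith
          linarith
        · have hp := hππ y y' hd h h'
          have hpe : π y x = π y x' := by
            refine hπ2 y h x x' (hnear y x hx) (hnear' y y' hd x' hx') (hxx.trans ?_)
            calc Λ * dist y y' ≤ Λ * (ρ y / 100) := by gcongr
              _ ≤ R * ρ y := by
                simp only [R]
                nlinarith [mul_nonneg hE (hρ0 y), mul_nonneg hΛ (hρ0 y)]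
          have e : g y x - g y' x' = (1 - t y') * (x - x') + (t y - t y') * (π y x - x) := by
            simp only [g]; rw [← hp, ← hpe]; ring
          rw [e]
          refine (abs_add_le _ _).trans ?_
          rw [abs_mul, abs_mul, abs_of_nonneg (by linarith [(ht y').2] : 0 ≤ 1 - t y')]
          have h3 := hπ1 y h x (hnear y x hx)
          have h4 : |t y - t y'| * |π y x - x| ≤ |t y - t y'| * (K * ρ y) := by gcongr
          have h5 : (1 - t y') * |x - x'| ≤ 1 * |x - x'| := by gcongr; linarith
          linarith
    refine ⟨E + K, Λ + 2 * L * K, by positivity, by positivity, fun y => img (Ψ y) (g y), ?_, ?_⟩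
    · intro y
      have hgx : ∀ x ∈ (Ψ y).1, |g y x - x| ≤ K * ρ y := by
        intro x hx
        have e : g y x - x = t y * (π y x - x) := by simp only [g]; ring
        rw [e, abs_mul, abs_of_nonneg (ht y).1]
        have := hρ0 y
        calc _ ≤ t y * (K * ρ y) := hmove y x hx
          _ ≤ 1 * (K * ρ y) := by gcongr; exact (ht y).2
          _ = _ := one_mul _
      have : Close (K * ρ y) (img (Ψ y) (g y)).1 (Ψ y).1 := by
        constructor
        · rintro _ ⟨x, hx, rfl⟩
          exact ⟨x, hx, hgx x hx⟩
        · intro x hx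
          exact ⟨_, ⟨x, hx, rfl⟩, by rw [abs_sub_comm]; exact hgx x hx⟩
      exact (this.trans (h1 y)).mono (by linarith)
    · rintro y y' ⟨c, hc, hF⟩ hd
      have hd0 : 0 ≤ dist y y' := dist_nonneg
      rcases Nat.lt_succ_iff_lt_or_eq.1 hc with hlt | rfl
      · have hcl := h2 y y' ⟨c, hlt, hF⟩ hd
        constructor
        · rintro _ ⟨x, hx, rfl⟩
          obtain ⟨x', hx', h⟩ := hcl.1 x hx
          exact ⟨_, ⟨x', hx', rfl⟩, hpair y y' hd x hx x' hx' h⟩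
        · rintro _ ⟨x', hx', rfl⟩
          obtain ⟨x, hx, h⟩ := hcl.2 x' hx'
          refine ⟨_, ⟨x, hx, rfl⟩, ?_⟩
          rw [abs_sub_comm] at h ⊢
          exact hpair y y' hd x hx x' hx' h
      · obtain ⟨ht1, ht2⟩ := hfull y y' hF hd
        have hp := hππ y y' hd (by rw [ht1]; norm_num) (by rw [ht2]; norm_num)
        have hz : ∀ x ∈ (Ψ y).1, ∀ x' ∈ (Ψ y').1, |x - x'| ≤ R * ρ y → g y x = g y' x' := by
          intro x hx x' hx' hxx
          have hpe : π y x = π y x' :=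
            hπ2 y (by rw [ht1]; norm_num) x x' (hnear y x hx) (hnear' y y' hd x' hx') hxx
          simp only [g]
          rw [ht1, ht2, ← hp, hpe]; ring
        have hnn : 0 ≤ (Λ + 2 * L * K) * dist y y' := by positivity
        constructor
        · rintro _ ⟨x, hx, rfl⟩
          obtain ⟨x', hx', h⟩ := (hΨΨ y y' hd).1 x hx
          exact ⟨_, ⟨x', hx', rfl⟩, by rw [hz x hx x' hx' h]; simpa using hnn⟩
        · rintro _ ⟨x', hx', rfl⟩
          obtain ⟨x, hx, h⟩ := (hΨΨ y y' hd).2 x' hx'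
          rw [abs_sub_comm] at h
          exact ⟨_, ⟨x, hx, rfl⟩, by rw [hz x hx x' hx' h]; simpa using hnn⟩

lemma main {n : ℕ} (hn : 1 ≤ n) {Y : Type*} [MetricSpace Y] (i : SP n → Y)
    (hi : ∀ A B : SP n, dist (i A) (i B) = hausdorffDist A.1 B.1) :
    ∃ (C : ℝ) (r : Y → SP n), 0 < C ∧
      (∀ y₁ y₂ : Y, hausdorffDist (r y₁).1 (r y₂).1 ≤ C * dist y₁ y₂) ∧
      (∀ A : SP n, r (i A) = A) := by
  obtain ⟨ρ, hρ⟩ : ∃ ρ : Y → ℝ, ρ = fun y => infDist y (Set.range i) := ⟨_, rfl⟩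
  have hρy : ∀ y, ρ y = infDist y (Set.range i) := fun y => by rw [hρ]
  have hρ0 : ∀ y, 0 ≤ ρ y := fun y => by rw [hρ]; exact infDist_nonneg
  have hne : (Set.range i).Nonempty :=
    ⟨_, ⟨⟨{0}, by simp, by simp, by simpa using hn⟩, rfl⟩⟩
  have ha : ∀ y, ∃ A : SP n, dist y (i A) ≤ 2 * ρ y := by
    intro y
    rcases (hρ0 y).eq_or_lt with h | h
    · obtain ⟨A, hA⟩ := mem_range_of_infDist hn i hi y (by rw [← hρy, ← h])
      exact ⟨A, by rw [hA, ← h]; simp⟩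
    · obtain ⟨_, ⟨A, rfl⟩, h'⟩ := (infDist_lt_iff hne (x := y) (r := 2 * ρ y)).1
        (by rw [← hρy]; linarith)
      exact ⟨A, h'.le⟩
  choose a ha using ha
  obtain ⟨E, Λ, hE, hΛ, Ψ, h1, h2⟩ := iter hn i hi a ρ hρ ha (2 * (n + 1))
  refine ⟨E * 300 + Λ + 1000, Ψ, by positivity, ?_, ?_⟩
  · intro y y'
    have hd0 : 0 ≤ dist y y' := dist_nonneg
    apply Close.hd (by positivity)
    by_cases hd : dist y y' ≤ ρ y / 100
    · rcases (hρ0 y).eq_or_lt with h | h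
      · have : y = y' := by
          rw [← dist_le_zero]; rw [← h] at hd; simpa using hd
        subst this
        exact ⟨fun b hb => ⟨b, hb, by simp⟩, fun b hb => ⟨b, hb, by simp⟩⟩
      · refine (h2 y y' ?_ hd).mono (by nlinarith)
        obtain ⟨p, hp, z, hz1, hz2⟩ := exists_scale (ρ y) h
        obtain ⟨j, hj, hjG⟩ := exists_G n (30 * (4 ^ p * (16:ℝ) ^ z)) (by positivity) (a y)
        refine ⟨2 * j + p, by omega, ?_⟩
        have e1 : (2 * j + p) % 2 = p := by omega
        have e2 : (2 * j + p) / 2 = j := by omega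
        rw [e1, e2]
        refine ⟨z, by rw [← hρy]; exact hz1, by rw [← hρy]; exact hz2, ?_⟩
        rw [← hρy]
        exact (infDist_le_dist_of_mem (Set.mem_image_of_mem i hjG)).trans (ha y)
    · push Not at hd
      have h3 : ρ y' ≤ ρ y + dist y y' := by
        rw [hρy, hρy, dist_comm]; exact infDist_le_infDist_add_dist
      have h4 : hausdorffDist (a y).1 (a y').1 ≤ 1000 * dist y y' := by
        rw [← hi]
        have e1 := dist_triangle_left (i (a y)) (i (a y')) y
        have e2 := dist_triangle y y' (i (a y'))
        have := ha y
        have := ha y'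
        linarith
      refine (((h1 y).trans (close_of_hd _ _ h4)).trans (h1 y').symm).mono ?_
      have h5 : E * ρ y ≤ E * (100 * dist y y') := by gcongr; linarith
      have h6 : E * ρ y' ≤ E * (101 * dist y y') := by gcongr; linarith
      nlinarith [mul_nonneg hE hd0, mul_nonneg hΛ hd0]
  · intro A
    have hz : ρ (i A) = 0 := by rw [hρy]; exact infDist_zero_of_mem ⟨A, rfl⟩
    have e1 := (h1 (i A))
    have e2 := ha (i A)
    rw [hz, mul_zero] at e1 e2
    rw [hi] at e2
    exact Subtype.ext (e1.eq.trans (close_of_hd _ _ e2).eq.symm)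

end KSP

/-- **Theorem 4 (Kovalev).** The symmetric product `ℝ^(n)` is an absolute Lipschitz retract:
for every metric space `Y` and every isometric embedding `i : ℝ^(n) → Y` there is a Lipschitz
map `r : Y → ℝ^(n)` with `r ∘ i = id`. -/
theorem symmetric_product_real_absolute_Lipschitz_retract (n : ℕ) (hn : 1 ≤ n)
    (Y : Type*) [MetricSpace Y]
    (i : {A : Set ℝ // A.Finite ∧ A.Nonempty ∧ A.ncard ≤ n} → Y)
    (hi : ∀ A B : {A : Set ℝ // A.Finite ∧ A.Nonempty ∧ A.ncard ≤ n},
      dist (i A) (i B) = hausdorffDist A.1 B.1) :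
    ∃ (C : ℝ) (r : Y → {A : Set ℝ // A.Finite ∧ A.Nonempty ∧ A.ncard ≤ n}), 0 < C ∧
      (∀ y₁ y₂ : Y, hausdorffDist (r y₁).1 (r y₂).1 ≤ C * dist y₁ y₂) ∧
      (∀ A : {A : Set ℝ // A.Finite ∧ A.Nonempty ∧ A.ncard ≤ n}, r (i A) = A) := by
  exact KSP.main hn i hi
end

section
/- Let n ≥ 1 and m ≥ 1 be integers and let f : ℝ^(n) → ℝ^m be a bi-Lipschitz embedding of the n-th symmetric product ℝ^(n) into ℝ^m. Then the image E = f(ℝ^(n)) is a Lipschitz retract of ℝ^m: there exists a Lipschitz map r : ℝ^m → ℝ^m whose range is contained in E and which fixes every point of E. -/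
open Metric

def SPLC {Z : Type*} [MetricSpace Z] (E : Set Z) (C : ℝ) : Prop :=
  ∀ p ∈ E, ∀ R : ℝ, 0 < R → ∃ q ∈ E, ∃ H : Z → ℝ → Z, ∀ y ∈ E, dist y p ≤ R →
    (∀ t, 0 ≤ t → t ≤ 1 → H y t ∈ E) ∧ H y 0 = y ∧ H y 1 = q ∧
    ∀ y' ∈ E, dist y' p ≤ R → ∀ s t, 0 ≤ s → s ≤ 1 → 0 ≤ t → t ≤ 1 →
      dist (H y s) (H y' t) ≤ C * (dist y y' + R * |s - t|)

/-- scale selection -/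
lemma sp_scale (k : ℕ) : ∀ (A : Finset ℝ), A.card = k → A.Nonempty → ∀ ρ : ℝ, 0 < ρ →
    ∃ B : Finset ℝ, B ⊆ A ∧ B.Nonempty ∧ ∃ ρ' : ℝ, ρ ≤ ρ' ∧ ρ' ≤ 6 ^ k * ρ ∧
      (∀ x ∈ A, ∃ a ∈ B, |x - a| ≤ ρ' - ρ) ∧
      (∀ a ∈ B, ∀ b ∈ B, a ≠ b → 4 * ρ' ≤ |a - b|) := by
  induction k with
  | zero =>
    intro A hA hne
    exact absurd (Finset.card_eq_zero.mp hA) hne.ne_empty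
  | succ k ih =>
    intro A hA hne ρ hρ
    by_cases hsep : ∀ a ∈ A, ∀ b ∈ A, a ≠ b → 4 * ρ ≤ |a - b|
    · refine ⟨A, subset_rfl, hne, ρ, le_rfl, ?_, fun x hx => ⟨x, hx, by simp⟩, hsep⟩
      have : (1 : ℝ) ≤ 6 ^ (k + 1) := one_le_pow₀ (by norm_num)
      nlinarith
    · push Not at hsep
      obtain ⟨x, hx, y, hy, hxy, hlt⟩ := hsep
      have hyA : y ∈ A.erase x := Finset.mem_erase.mpr ⟨hxy.symm, hy⟩
      obtain ⟨B, hBA, hB, ρ', h1, h2, h3, h4⟩ := ih (A.erase x)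
        (by rw [Finset.card_erase_of_mem hx, hA]; rfl) ⟨y, hyA⟩ (5 * ρ) (by linarith)
      refine ⟨B, hBA.trans (Finset.erase_subset _ _), hB, ρ', by linarith, ?_, ?_, h4⟩
      · have : (0 : ℝ) < 6 ^ k := by positivity
        rw [pow_succ]; nlinarith [mul_pos this hρ]
      · intro z hz
        by_cases hzx : z = x
        · obtain ⟨a, ha, hay⟩ := h3 y hyA
          refine ⟨a, ha, ?_⟩
          have := abs_sub_le z y a
          subst hzx
          linarith
        · obtain ⟨a, ha, hay⟩ := h3 z (Finset.mem_erase.mpr ⟨hzx, hz⟩)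
          exact ⟨a, ha, by linarith⟩

lemma sp_near {A B : Set ℝ} (hA : A.Finite) (hA' : A.Nonempty) (hB : B.Finite) (hB' : B.Nonempty)
    {x : ℝ} (hx : x ∈ A) : ∃ y ∈ B, |x - y| ≤ hausdorffDist A B := by
  obtain ⟨y, hy, h⟩ := hB.isCompact.exists_infDist_eq_dist hB' x
  refine ⟨y, hy, ?_⟩
  rw [← Real.dist_eq, ← h]
  exact infDist_le_hausdorffDist_of_mem hx
    (hausdorffEDist_ne_top_of_nonempty_of_bounded hA' hB' hA.isBounded hB.isBounded)

/-- local contraction in the symmetric product -/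
lemma sp_contract (n : ℕ) (A₀ : Set ℝ) (hf₀ : A₀.Finite) (hn₀ : A₀.Nonempty) (hc₀ : A₀.ncard ≤ n)
    (ρ : ℝ) (hρ : 0 < ρ) :
    ∃ A₁ : Set ℝ, A₁.Finite ∧ A₁.Nonempty ∧ A₁.ncard ≤ n ∧ ∃ h : ℝ → ℝ → ℝ,
      ∀ A : Set ℝ, A.Finite → A.Nonempty → hausdorffDist A A₀ ≤ ρ →
        (h 0 '' A = A) ∧ (h 1 '' A = A₁) ∧
        ∀ B : Set ℝ, B.Finite → B.Nonempty → hausdorffDist B A₀ ≤ ρ →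
        ∀ s t, 0 ≤ s → s ≤ 1 → 0 ≤ t → t ≤ 1 →
          hausdorffDist (h s '' A) (h t '' B) ≤ 2 * hausdorffDist A B + 6 ^ n * ρ * |s - t| := by
  classical
  obtain ⟨B₁, hBA, hB, ρ', h1, h2, h3, h4⟩ := sp_scale _ hf₀.toFinset rfl
    (by simpa using hn₀) ρ hρ
  have hρn : ρ' ≤ 6 ^ n * ρ := by
    refine h2.trans ?_
    have : hf₀.toFinset.card ≤ n := by rwa [← Set.ncard_eq_toFinset_card _ hf₀]
    gcongr
    norm_num
  have hρ' : 0 < ρ' := hρ.trans_le h1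
  -- projection
  have hπ : ∃ π : ℝ → ℝ, ∀ x, (∃ a ∈ B₁, |x - a| ≤ ρ') → π x ∈ B₁ ∧ |x - π x| ≤ ρ' := by
    have : ∀ x, ∃ b, (∃ a ∈ B₁, |x - a| ≤ ρ') → b ∈ B₁ ∧ |x - b| ≤ ρ' := by
      intro x
      by_cases hx : ∃ a ∈ B₁, |x - a| ≤ ρ'
      · obtain ⟨a, ha⟩ := hx
        exact ⟨a, fun _ => ha⟩
      · exact ⟨0, fun h => absurd h hx⟩
    choose π hπ using this
    exact ⟨π, hπ⟩
  obtain ⟨π, hπ⟩ := hπ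
  have near : ∀ A : Set ℝ, A.Finite → A.Nonempty → hausdorffDist A A₀ ≤ ρ → ∀ x ∈ A,
      π x ∈ B₁ ∧ |x - π x| ≤ ρ' := by
    intro A hA hA' hd x hx
    apply hπ
    obtain ⟨y, hy, hxy⟩ := sp_near hA hA' hf₀ hn₀ hx
    obtain ⟨a, ha, hya⟩ := h3 y (by simpa using hy)
    refine ⟨a, ha, ?_⟩
    have := abs_sub_le x y a
    linarith
  set h : ℝ → ℝ → ℝ := fun t x => (1 - t) * x + t * π x with hh
  have key : ∀ x y, (π x ∈ B₁ ∧ |x - π x| ≤ ρ') → (π y ∈ B₁ ∧ |y - π y| ≤ ρ') →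
      ∀ s t, 0 ≤ s → s ≤ 1 → 0 ≤ t → t ≤ 1 → |h s x - h t y| ≤ 2 * |x - y| + ρ' * |s - t| := by
    rintro x y ⟨hx, hx'⟩ ⟨hy, hy'⟩ s t hs hs' ht ht'
    have e1 : |h s x - h t x| ≤ ρ' * |s - t| := by
      have : h s x - h t x = (t - s) * (x - π x) := by simp only [hh]; ring
      rw [this, abs_mul, abs_sub_comm t s, mul_comm]
      gcongr
    have e2 : |h t x - h t y| ≤ 2 * |x - y| := by
      by_cases hxy : π x = π y
      · have : h t x - h t y = (1 - t) * (x - y) := by simp only [hh, hxy]; ring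
        rw [this, abs_mul, abs_of_nonneg (by linarith)]
        nlinarith [abs_nonneg (x - y)]
      · have hs := h4 _ hx _ hy hxy
        have : h t x - h t y = (x - y) - t * (x - π x) + t * (y - π y) := by
          simp only [hh]; ring
        have a1 : |t * (x - π x)| ≤ ρ' := by
          rw [abs_mul, abs_of_nonneg ht]; nlinarith [abs_nonneg (x - π x)]
        have a2 : |t * (y - π y)| ≤ ρ' := by
          rw [abs_mul, abs_of_nonneg ht]; nlinarith [abs_nonneg (y - π y)]
        have b1 := abs_sub_le (π x) x (π y)
        have b2 := abs_sub_le x y (π y)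
        rw [abs_sub_comm (π x) x] at b1
        rw [this]
        have c1 := abs_add_le ((x - y) - t * (x - π x)) (t * (y - π y))
        have c2 := abs_sub (x - y) (t * (x - π x))
        linarith
    have := abs_sub_le (h s x) (h t x) (h t y)
    linarith
  refine ⟨B₁, B₁.finite_toSet, by simpa using hB, ?_, h, ?_⟩
  · refine le_trans (Set.ncard_le_ncard ?_ hf₀) hc₀
    intro x hx
    simpa using hBA hx
  intro A hA hA' hd
  refine ⟨?_, ?_, ?_⟩
  · simp [hh]
  · simp only [hh]
    ext z
    constructor
    · rintro ⟨x, hx, rfl⟩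
      simpa using (near A hA hA' hd x hx).1
    · intro hz
      have hz0 : z ∈ A₀ := by simpa using hBA hz
      obtain ⟨x, hx, hzx⟩ := sp_near hf₀ hn₀ hA hA' hz0
      rw [hausdorffDist_comm] at hzx
      refine ⟨x, hx, ?_⟩
      obtain ⟨g1, g2⟩ := near A hA hA' hd x hx
      by_contra hne
      have hne' : π x ≠ z := by intro h; apply hne; simp [h]
      have := h4 _ g1 _ hz hne'
      have b1 := abs_sub_le (π x) x z
      rw [abs_sub_comm (π x) x, abs_sub_comm x z] at b1
      linarith
  · intro B hB hB' hdB s t hs hs' ht ht'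
    have hH : 0 ≤ hausdorffDist A B := hausdorffDist_nonneg
    have hle : ρ' * |s - t| ≤ 6 ^ n * ρ * |s - t| := by gcongr
    apply hausdorffDist_le_of_mem_dist
    · have := abs_nonneg (s - t); positivity
    · rintro _ ⟨x, hx, rfl⟩
      obtain ⟨y, hy, hxy⟩ := sp_near hA hA' hB hB' hx
      refine ⟨_, ⟨y, hy, rfl⟩, ?_⟩
      rw [Real.dist_eq]
      have := key x y (near A hA hA' hd x hx) (near B hB hB' hdB y hy) s t hs hs' ht ht'
      linarith
    · rintro _ ⟨x, hx, rfl⟩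
      obtain ⟨y, hy, hxy⟩ := sp_near hB hB' hA hA' hx
      refine ⟨_, ⟨y, hy, rfl⟩, ?_⟩
      rw [Real.dist_eq]
      have := key x y (near B hB hB' hdB x hx) (near A hA hA' hd y hy) t s ht ht' hs hs'
      rw [hausdorffDist_comm] at hxy
      rw [abs_sub_comm t s] at this
      linarith

lemma sp_range_LC {Z : Type*} [MetricSpace Z] (n : ℕ) (L : ℝ) (hL : 1 ≤ L)
    (f : {A : Set ℝ // A.Finite ∧ A.Nonempty ∧ A.ncard ≤ n} → Z)
    (hf : ∀ A B : {A : Set ℝ // A.Finite ∧ A.Nonempty ∧ A.ncard ≤ n},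
      L⁻¹ * hausdorffDist A.1 B.1 ≤ dist (f A) (f B) ∧
      dist (f A) (f B) ≤ L * hausdorffDist A.1 B.1) :
    SPLC (Set.range f) (2 * L ^ 2 * 6 ^ n) := by
  classical
  have hL0 : 0 < L := by linarith
  have hlow : ∀ A B, hausdorffDist A.1 B.1 ≤ L * dist (f A) (f B) := by
    intro A B
    have := (hf A B).1
    rwa [inv_mul_le_iff₀ hL0] at this
  rintro _ ⟨A₀, rfl⟩ R hR
  obtain ⟨A₁, a1, a2, a3, h, hh⟩ := sp_contract n A₀.1 A₀.2.1 A₀.2.2.1 A₀.2.2.2 (L * R)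
    (by positivity)
  have hcard : ∀ (A : {A : Set ℝ // A.Finite ∧ A.Nonempty ∧ A.ncard ≤ n}) (g : ℝ → ℝ),
      (g '' A.1).Finite ∧ (g '' A.1).Nonempty ∧ (g '' A.1).ncard ≤ n := fun A g =>
    ⟨A.2.1.image g, A.2.2.1.image g, (Set.ncard_image_le A.2.1).trans A.2.2.2⟩
  have : Nonempty {A : Set ℝ // A.Finite ∧ A.Nonempty ∧ A.ncard ≤ n} := ⟨A₀⟩
  set gi := Function.invFun f with hgi
  have hfi : ∀ y ∈ Set.range f, f (gi y) = y := fun y hy => Function.invFun_eq hy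
  have hball : ∀ y ∈ Set.range f, dist y (f A₀) ≤ R → hausdorffDist (gi y).1 A₀.1 ≤ L * R := by
    intro y hy hd
    refine (hlow _ _).trans ?_
    rw [hfi y hy]
    gcongr
  refine ⟨f ⟨A₁, a1, a2, a3⟩, ⟨_, rfl⟩, fun y t => f ⟨h t '' (gi y).1, hcard _ _⟩, ?_⟩
  intro y hy hd
  obtain ⟨k1, k2, k3⟩ := hh (gi y).1 (gi y).2.1 (gi y).2.2.1 (hball y hy hd)
  refine ⟨fun t _ _ => ⟨_, rfl⟩, ?_, ?_, ?_⟩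
  · simp only [k1, Subtype.coe_eta]
    exact hfi y hy
  · simp only [k2]
  · intro y' hy' hd' s t hs hs' ht ht'
    have := k3 (gi y').1 (gi y').2.1 (gi y').2.2.1 (hball y' hy' hd') s t hs hs' ht ht'
    refine (hf _ _).2.trans ?_
    have h2 := hlow (gi y) (gi y')
    rw [hfi y hy, hfi y' hy'] at h2
    have h6 : (1 : ℝ) ≤ 6 ^ n := one_le_pow₀ (by norm_num)
    have hst := abs_nonneg (s - t)
    have hdd : 0 ≤ dist y y' := dist_nonneg
    calc L * hausdorffDist (h s '' (gi y).1) (h t '' (gi y').1)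
        ≤ L * (2 * (L * dist y y') + 6 ^ n * (L * R) * |s - t|) := by gcongr; linarith
      _ = 2 * L ^ 2 * 1 * dist y y' + 1 * L ^ 2 * 6 ^ n * (R * |s - t|) := by ring
      _ ≤ 2 * L ^ 2 * 6 ^ n * dist y y' + 2 * L ^ 2 * 6 ^ n * (R * |s - t|) := by
          gcongr; norm_num
      _ = _ := by ring

lemma sp_range_closed {Z : Type*} [MetricSpace Z] (n : ℕ) (hn : 1 ≤ n) (L : ℝ) (hL : 1 ≤ L)
    (f : {A : Set ℝ // A.Finite ∧ A.Nonempty ∧ A.ncard ≤ n} → Z)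
    (hf : ∀ A B : {A : Set ℝ // A.Finite ∧ A.Nonempty ∧ A.ncard ≤ n},
      L⁻¹ * hausdorffDist A.1 B.1 ≤ dist (f A) (f B) ∧
      dist (f A) (f B) ≤ L * hausdorffDist A.1 B.1) :
    IsClosed (Set.range f) := by
  classical
  have hL0 : 0 < L := by linarith
  have : Nonempty (Fin n) := ⟨⟨0, hn⟩⟩
  have hr : ∀ a : Fin n → ℝ, (Set.range a).Finite ∧ (Set.range a).Nonempty ∧
      (Set.range a).ncard ≤ n := by
    intro a
    refine ⟨Set.finite_range a, Set.range_nonempty a, ?_⟩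
    rw [← Set.image_univ]
    refine (Set.ncard_image_le Set.finite_univ).trans ?_
    simp [Set.ncard_univ]
  set F : (Fin n → ℝ) → Z := fun a => f ⟨Set.range a, hr a⟩ with hF
  have hFc : Continuous F := by
    apply LipschitzWith.continuous (K := L.toNNReal)
    apply LipschitzWith.of_dist_le_mul
    intro a b
    refine (hf _ _).2.trans ?_
    rw [Real.coe_toNNReal _ hL0.le]
    gcongr
    apply hausdorffDist_le_of_mem_dist dist_nonneg
    · rintro _ ⟨i, rfl⟩
      exact ⟨b i, ⟨i, rfl⟩, dist_le_pi_dist a b i⟩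
    · rintro _ ⟨i, rfl⟩
      exact ⟨a i, ⟨i, rfl⟩, by rw [dist_comm a b]; exact dist_le_pi_dist b a i⟩
  have hsurj : ∀ A : {A : Set ℝ // A.Finite ∧ A.Nonempty ∧ A.ncard ≤ n},
      ∃ a : Fin n → ℝ, Set.range a = A.1 := by
    rintro ⟨A, h1, h2, h3⟩
    have := h1.fintype
    have : Nonempty A := h2.to_subtype
    obtain ⟨e⟩ : Nonempty (A ↪ Fin n) := by
      apply Function.Embedding.nonempty_of_card_le
      rw [Fintype.card_fin, ← Nat.card_eq_fintype_card]
      exact h3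
    refine ⟨fun i => (Function.invFun e i : A).1, ?_⟩
    have : Function.Surjective (Function.invFun e) := Function.invFun_surjective e.injective
    ext z
    constructor
    · rintro ⟨i, rfl⟩
      exact (Function.invFun e i).2
    · intro hz
      obtain ⟨i, hi⟩ := this ⟨z, hz⟩
      exact ⟨i, by simp [hi]⟩
  rw [← isSeqClosed_iff_isClosed]
  intro u x hu hx
  obtain ⟨M, hM⟩ := (Metric.isBounded_range_of_tendsto u hx).subset_closedBall (F 0)
  choose A hA using hu
  choose a ha using fun k => hsurj (A k)
  have huF : ∀ k, u k = F (a k) := by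
    intro k
    rw [← hA k, hF]
    congr 1
    exact Subtype.ext (ha k).symm
  have hM0 : 0 ≤ M := dist_nonneg.trans (hM ⟨0, rfl⟩)
  have hak : ∀ k, a k ∈ closedBall (0 : Fin n → ℝ) (L * M) := by
    intro k
    rw [mem_closedBall, dist_pi_le_iff (by positivity)]
    intro i
    obtain ⟨y, ⟨j, rfl⟩, hy⟩ := sp_near (hr (a k)).1 (hr (a k)).2.1 (hr 0).1 (hr 0).2.1
      (Set.mem_range_self i)
    rw [Real.dist_eq]
    refine hy.trans ?_
    have h1 := (hf ⟨Set.range (a k), hr _⟩ ⟨Set.range (0 : Fin n → ℝ), hr _⟩).1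
    rw [inv_mul_le_iff₀ hL0] at h1
    refine h1.trans ?_
    have h2 : dist (u k) (F 0) ≤ M := hM ⟨k, rfl⟩
    rw [huF k] at h2
    gcongr
  have hcl : IsClosed (F '' closedBall (0 : Fin n → ℝ) (L * M)) :=
    ((isCompact_closedBall _ _).image hFc).isClosed
  obtain ⟨b, -, hb⟩ := hcl.mem_of_tendsto hx
    (Filter.Eventually.of_forall fun k => ⟨a k, hak k, (huF k).symm⟩)
  exact ⟨_, hb⟩

/-- partial Lipschitz retraction defined on `U` -/
def SPPart {Z : Type*} [MetricSpace Z] (E U : Set Z) : Prop :=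
  ∃ L : ℝ, 1 ≤ L ∧ E ⊆ U ∧ ∃ g : Z → Z, (∀ x ∈ E, g x = x) ∧ (∀ x ∈ U, g x ∈ E) ∧
    ∀ x ∈ U, ∀ y ∈ U, dist (g x) (g y) ≤ L * dist x y

lemma sp_cutoff {Z : Type*} [MetricSpace Z] (c : Z) (r : ℝ) (hr : 0 < r) :
    ∃ φ : Z → ℝ, (∀ x, 0 ≤ φ x) ∧ (∀ x, φ x ≤ 1) ∧ (∀ x, dist x c ≤ r → φ x = 1) ∧
      (∀ x, 2 * r ≤ dist x c → φ x = 0) ∧ ∀ x y, r * |φ x - φ y| ≤ dist x y := by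
  refine ⟨fun x => max 0 (min 1 (2 - dist x c / r)), fun x => le_max_left _ _,
    fun x => max_le zero_le_one (min_le_left _ _), ?_, ?_, ?_⟩
  · intro x hx
    have : dist x c / r ≤ 1 := by rwa [div_le_one hr]
    have h2 : min 1 (2 - dist x c / r) = 1 := min_eq_left (by linarith)
    simp [h2]
  · intro x hx
    have : 2 ≤ dist x c / r := by rwa [le_div_iff₀ hr]
    apply max_eq_left
    exact (min_le_right _ _).trans (by linarith)
  · intro x y
    have h1 : |max 0 (min 1 (2 - dist x c / r)) - max 0 (min 1 (2 - dist y c / r))|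
        ≤ |(2 - dist x c / r) - (2 - dist y c / r)| := by
      refine (abs_max_sub_max_le_max _ _ _ _).trans ?_
      simp only [sub_self, abs_zero]
      refine max_le (abs_nonneg _) ?_
      refine (abs_min_sub_min_le_max _ _ _ _).trans ?_
      simp only [sub_self, abs_zero]
      exact max_le (abs_nonneg _) le_rfl
    have h2 : (2 - dist x c / r) - (2 - dist y c / r) = (dist y c - dist x c) / r := by ring
    rw [h2, abs_div, abs_of_pos hr] at h1
    have h3 : |dist y c - dist x c| ≤ dist x y := by
      rw [dist_comm x y]; exact abs_dist_sub_le y x c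
    calc _ ≤ r * (|dist y c - dist x c| / r) := by gcongr
      _ = |dist y c - dist x c| := by field_simp
      _ ≤ _ := h3

lemma sp_step {Z : Type*} [MetricSpace Z] (E U : Set Z) (C : ℝ) (hC : 0 ≤ C) (hE : SPLC E C)
    (hU : SPPart E U) {I : Type*} (c : I → Z) (r : I → ℝ) (K : ℝ) (hK : 0 ≤ K)
    (hr : ∀ i, 0 < r i) (hfar : ∀ i, ∀ e ∈ E, 2 * r i ≤ dist e (c i))
    (hnear : ∀ i, ∃ e ∈ E, dist e (c i) ≤ K * r i)
    (hdisj : ∀ i j, ∀ x, dist x (c i) < 2 * r i → dist x (c j) < 2 * r j → i = j) :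
    SPPart E (U ∪ {x | ∃ i, dist x (c i) ≤ r i}) := by
  classical
  obtain ⟨L, hL, hEU, g, hg1, hg2, hg3⟩ := hU
  choose e he hec using hnear
  choose φ φ0 φ1 φc φf φL using fun i => sp_cutoff (c i) (r i) (hr i)
  set ρ : ℝ := L * (K + 2) with hρ
  have hρ0 : 0 < ρ := by positivity
  choose q hq H hH using fun i => hE (e i) (he i) (ρ * r i) (mul_pos hρ0 (hr i))
  have hball : ∀ i, ∀ x ∈ U, dist x (c i) < 2 * r i → dist (g x) (e i) ≤ ρ * r i := by
    intro i x hx hxi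
    have h1 := hg3 x hx (e i) (hEU (he i))
    rw [hg1 _ (he i)] at h1
    have h2 := dist_triangle_right x (e i) (c i)
    calc _ ≤ _ := h1
      _ ≤ L * ((K + 2) * r i) := by gcongr; linarith [hec i]
      _ = _ := by rw [hρ]; ring
  set g' : Z → Z := fun x => if h : ∃ i, dist x (c i) < 2 * r i then
      (if x ∈ U then H h.choose (g x) (φ h.choose x) else q h.choose) else g x with hg'
  have gin : ∀ i x, dist x (c i) < 2 * r i → x ∈ U → g' x = H i (g x) (φ i x) := by
    intro i x hx hxU
    have h : ∃ i, dist x (c i) < 2 * r i := ⟨i, hx⟩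
    have : h.choose = i := hdisj _ _ x h.choose_spec hx
    simp only [hg', dif_pos h, if_pos hxU, this]
  have gin' : ∀ i x, dist x (c i) < 2 * r i → x ∉ U → g' x = q i := by
    intro i x hx hxU
    have h : ∃ i, dist x (c i) < 2 * r i := ⟨i, hx⟩
    have : h.choose = i := hdisj _ _ x h.choose_spec hx
    simp only [hg', dif_pos h, if_neg hxU, this]
  have gout : ∀ x, (¬ ∃ i, dist x (c i) < 2 * r i) → g' x = g x := by
    intro x h
    simp only [hg', dif_neg h]
  have hcore : ∀ x ∈ U ∪ {x | ∃ i, dist x (c i) ≤ r i}, x ∉ U →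
      ∃ i, dist x (c i) < 2 * r i ∧ φ i x = 1 := by
    rintro x (hx | ⟨i, hi⟩) hxU
    · exact absurd hx hxU
    · exact ⟨i, by linarith [hr i], φc i x hi⟩
  have hmove : ∀ i, ∀ x ∈ U, dist x (c i) < 2 * r i → ∀ t, 0 ≤ t → t ≤ 1 →
      dist (H i (g x) t) (g x) ≤ C * ρ * (r i * t) := by
    intro i x hx hxi t ht ht'
    have hb := hball i x hx hxi
    obtain ⟨-, h0, -, h4⟩ := hH i (g x) (hg2 x hx) hb
    have := h4 (g x) (hg2 x hx) hb t 0 ht ht' le_rfl zero_le_one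
    rw [h0, dist_self, sub_zero, abs_of_nonneg ht] at this
    linarith
  have hqe : ∀ i, dist (q i) (e i) ≤ C * ρ * r i := by
    intro i
    have hb : dist (e i) (e i) ≤ ρ * r i := by
      rw [dist_self]; exact (mul_pos hρ0 (hr i)).le
    obtain ⟨-, h0, h1, h4⟩ := hH i (e i) (he i) hb
    have := h4 (e i) (he i) hb 1 0 zero_le_one le_rfl le_rfl zero_le_one
    rw [h0, h1, dist_self, sub_zero, abs_one] at this
    linarith
  have hanchor : ∀ x ∈ U ∪ {x | ∃ i, dist x (c i) ≤ r i}, ∀ y,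
      (∀ i, ¬ (dist x (c i) < 2 * r i ∧ dist y (c i) < 2 * r i)) →
      ∃ a ∈ U, dist x a ≤ (K + 2) * dist x y ∧ dist (g' x) (g a) ≤ C * ρ * dist x y := by
    intro x hx y hxy
    have hd : 0 ≤ dist x y := dist_nonneg
    by_cases hxU : x ∈ U
    · refine ⟨x, hxU, by rw [dist_self]; positivity, ?_⟩
      by_cases h : ∃ i, dist x (c i) < 2 * r i
      · obtain ⟨i, hi⟩ := h
        rw [gin i x hi hxU]
        refine (hmove i x hxU hi _ (φ0 i x) (φ1 i x)).trans ?_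
        have hy : φ i y = 0 := φf i y (not_lt.mp fun h => hxy i ⟨hi, h⟩)
        have := φL i x y
        rw [hy, sub_zero, abs_of_nonneg (φ0 i x)] at this
        gcongr
      · rw [gout x h, dist_self]; positivity
    · obtain ⟨i, hi, hφ⟩ := hcore x hx hxU
      have hy : φ i y = 0 := φf i y (not_lt.mp fun h => hxy i ⟨hi, h⟩)
      have := φL i x y
      rw [hy, hφ, sub_zero, abs_one, mul_one] at this
      refine ⟨e i, hEU (he i), ?_, ?_⟩
      · have h2 := dist_triangle_right x (e i) (c i)
        calc dist x (e i) ≤ (K + 2) * r i := by linarith [hec i]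
          _ ≤ _ := by gcongr
      · rw [gin' i x hi hxU, hg1 _ (he i)]
        refine (hqe i).trans ?_
        gcongr
  refine ⟨C * (L + ρ) + 2 * (C * ρ) + L * (2 * (K + 2) + 1), ?_,
    hEU.trans Set.subset_union_left, g', ?_, ?_, ?_⟩
  · have : 0 ≤ C * (L + ρ) + 2 * (C * ρ) := by positivity
    nlinarith
  · intro x hx
    rw [gout x, hg1 x hx]
    rintro ⟨i, hi⟩
    exact absurd (hfar i x hx) (not_le.mpr hi)
  · intro x hx
    by_cases hxU : x ∈ U
    · by_cases h : ∃ i, dist x (c i) < 2 * r i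
      · obtain ⟨i, hi⟩ := h
        rw [gin i x hi hxU]
        exact (hH i (g x) (hg2 x hxU) (hball i x hxU hi)).1 _ (φ0 i x) (φ1 i x)
      · rw [gout x h]; exact hg2 x hxU
    · obtain ⟨i, hi, -⟩ := hcore x hx hxU
      rw [gin' i x hi hxU]; exact hq i
  · intro x hx y hy
    have hd : 0 ≤ dist x y := dist_nonneg
    have hCL : 0 ≤ C * L * dist x y := by positivity
    have hCρ : 0 ≤ C * ρ * dist x y := by positivity
    have hLK : 0 ≤ L * (2 * (K + 2) + 1) * dist x y := by positivity
    by_cases hsame : ∀ i, ¬ (dist x (c i) < 2 * r i ∧ dist y (c i) < 2 * r i)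
    · obtain ⟨a, ha, ha1, ha2⟩ := hanchor x hx y hsame
      obtain ⟨b, hb, hb1, hb2⟩ := hanchor y hy x (fun i h => hsame i h.symm)
      rw [dist_comm y x] at hb1 hb2
      have h1 := hg3 a ha b hb
      have h2 : dist a b ≤ (2 * (K + 2) + 1) * dist x y := by
        have := dist_triangle4 a x y b
        rw [dist_comm a x] at this
        linarith
      have h3 : L * dist a b ≤ L * ((2 * (K + 2) + 1) * dist x y) := by gcongr
      have h4 := dist_triangle4 (g' x) (g a) (g b) (g' y)
      rw [dist_comm (g b) (g' y)] at h4
      linarith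
    · push Not at hsame
      obtain ⟨i, hi, hj⟩ := hsame
      have hφ : ρ * r i * |φ i x - φ i y| ≤ ρ * dist x y := by
        rw [mul_assoc]; have := φL i x y; gcongr
      suffices dist (g' x) (g' y) ≤ C * (L * dist x y + ρ * dist x y) by linarith
      by_cases hxU : x ∈ U
      · have hbx := hball i x hxU hi
        obtain ⟨-, -, hx1, hx4⟩ := hH i (g x) (hg2 x hxU) hbx
        rw [gin i x hi hxU]
        by_cases hyU : y ∈ U
        · rw [gin i y hj hyU]
          refine (hx4 (g y) (hg2 y hyU) (hball i y hyU hj) _ _ (φ0 i x) (φ1 i x) (φ0 i y)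
            (φ1 i y)).trans ?_
          have := hg3 x hxU y hyU
          gcongr
        · rw [gin' i y hj hyU, ← hx1]
          obtain ⟨j, hj', hφy⟩ := hcore y hy hyU
          obtain rfl := hdisj _ _ y hj hj'
          refine (hx4 (g x) (hg2 x hxU) hbx _ _ (φ0 i x) (φ1 i x) zero_le_one le_rfl).trans ?_
          rw [← hφy, dist_self]
          have : 0 ≤ L * dist x y := by positivity
          gcongr
      · rw [gin' i x hi hxU]
        obtain ⟨j, hj', hφx⟩ := hcore x hx hxU
        obtain rfl := hdisj _ _ x hi hj'
        by_cases hyU : y ∈ U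
        · have hby := hball i y hyU hj
          obtain ⟨-, -, hy1, hy4⟩ := hH i (g y) (hg2 y hyU) hby
          rw [gin i y hj hyU, ← hy1]
          refine (hy4 (g y) (hg2 y hyU) hby _ _ zero_le_one le_rfl (φ0 i y) (φ1 i y)).trans ?_
          rw [← hφx, dist_self]
          have : 0 ≤ L * dist x y := by positivity
          gcongr
        · rw [gin' i y hj hyU, dist_self]; positivity

lemma sp_iter {Z : Type*} [MetricSpace Z] (E : Set Z) (C : ℝ) (hC : 0 ≤ C) (hE : SPLC E C)
    {κ I : Type*} [Fintype κ] (col : I → κ) (c : I → Z) (r : I → ℝ) (K : ℝ) (hK : 0 ≤ K)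
    (hr : ∀ i, 0 < r i) (hfar : ∀ i, ∀ e ∈ E, 2 * r i ≤ dist e (c i))
    (hnear : ∀ i, ∃ e ∈ E, dist e (c i) ≤ K * r i)
    (hdisj : ∀ i j, col i = col j →
      ∀ x, dist x (c i) < 2 * r i → dist x (c j) < 2 * r j → i = j)
    (hcov : ∀ x, x ∉ E → ∃ i, dist x (c i) ≤ r i) :
    SPPart E Set.univ := by
  classical
  have key : ∀ S : Finset κ, SPPart E (E ∪ {x | ∃ i, col i ∈ S ∧ dist x (c i) ≤ r i}) := by
    intro S
    induction S using Finset.induction_on with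
    | empty => 
      refine ⟨1, le_rfl, Set.subset_union_left, id, ?_, ?_, ?_⟩ <;> simp
    | insert k S hk ih =>
      have := sp_step E _ C hC hE ih (I := {i // col i = k}) (fun i => c i.1) (fun i => r i.1) K hK
        (fun i => hr i.1) (fun i => hfar i.1) (fun i => hnear i.1)
        (fun i j x h1 h2 => Subtype.ext (hdisj i.1 j.1 (i.2.trans j.2.symm) x h1 h2))
      convert this using 1
      ext x
      simp only [Set.mem_union, Set.mem_ofPred_eq, Finset.mem_insert, Subtype.exists]
      constructor
      · rintro (h | ⟨i, (h | h), h'⟩)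
        · exact Or.inl (Or.inl h)
        · exact Or.inr ⟨i, h, h'⟩
        · exact Or.inl (Or.inr ⟨i, h, h'⟩)
      · rintro ((h | ⟨i, h, h'⟩) | ⟨i, h, h'⟩)
        · exact Or.inl h
        · exact Or.inr ⟨i, Or.inr h, h'⟩
        · exact Or.inr ⟨i, Or.inl h, h'⟩
  convert key Finset.univ using 1
  symm
  rw [Set.eq_univ_iff_forall]
  intro x
  by_cases hx : x ∈ E
  · exact Or.inl hx
  · obtain ⟨i, hi⟩ := hcov x hx
    exact Or.inr ⟨i, Finset.mem_univ _, hi⟩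

lemma sp_final (m : ℕ) (hm : 1 ≤ m) (E : Set (EuclideanSpace ℝ (Fin m))) (hcl : IsClosed E)
    (hne : E.Nonempty) (C : ℝ) (hC : 0 ≤ C) (hE : SPLC E C) : SPPart E Set.univ := by
  classical
  have hm0 : (0 : ℝ) < m := by exact_mod_cast hm
  have : NeZero (4 * m) := ⟨by omega⟩
  -- grid
  set rad : ℤ → ℝ := fun k => (2 : ℝ) ^ k / 16 with hrad
  have hradpos : ∀ k, 0 < rad k := fun k => by simp only [hrad]; positivity
  set pt : ℤ × (Fin m → ℤ) → EuclideanSpace ℝ (Fin m) :=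
    fun p => WithLp.toLp 2 (fun j => (p.2 j : ℝ) * (rad p.1 / m)) with hpt
  have hcoord : ∀ (x y : EuclideanSpace ℝ (Fin m)) j, |x j - y j| ≤ dist x y := by
    intro x y j
    rw [dist_eq_norm]
    have := PiLp.norm_apply_le (x - y) j
    simpa using this
  have hsum : ∀ (x y : EuclideanSpace ℝ (Fin m)) (δ : ℝ), 0 ≤ δ → (∀ j, |x j - y j| ≤ δ) →
      dist x y ≤ m * δ := by
    intro x y δ hδ h
    rw [EuclideanSpace.dist_eq]
    apply Real.sqrt_le_iff.mpr
    refine ⟨by positivity, ?_⟩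
    calc ∑ i, dist (x i) (y i) ^ 2 ≤ ∑ i : Fin m, δ ^ 2 := by
          apply Finset.sum_le_sum
          intro i _
          rw [Real.dist_eq]
          have := h i
          gcongr
      _ = m * δ ^ 2 := by simp
      _ ≤ (m * δ) ^ 2 := by
          rw [mul_pow]
          have : (1 : ℝ) ≤ m := by exact_mod_cast hm
          have h2 : (m : ℝ) ≤ m ^ 2 := by nlinarith
          gcongr
  have hlip : ∀ x y, infDist x E ≤ infDist y E + dist x y := fun x y => infDist_le_infDist_add_dist
  let I := {p : ℤ × (Fin m → ℤ) // 15 * rad p.1 ≤ infDist (pt p) E ∧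
    infDist (pt p) E ≤ 33 * rad p.1}
  refine sp_iter E C hC hE (κ := ZMod 3 × (Fin m → ZMod (4 * m))) (I := I)
    (fun p => ((p.1.1 : ZMod 3), fun j => (p.1.2 j : ZMod (4 * m))))
    (fun p => pt p.1) (fun p => rad p.1.1) 34 (by norm_num) (fun p => hradpos _) ?_ ?_ ?_ ?_
  · intro p e he
    have h1 := infDist_le_dist_of_mem (x := pt p.1) he
    rw [dist_comm] at h1
    linarith [p.2.1, hradpos p.1.1]
  · intro p
    have h1 : infDist (pt p.1) E < 34 * rad p.1.1 := by linarith [p.2.2, hradpos p.1.1]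
    obtain ⟨e, he, hlt⟩ := (infDist_lt_iff hne).mp h1
    exact ⟨e, he, by rw [dist_comm]; exact hlt.le⟩
  · -- disjointness
    have hlt : ∀ p q : I, (p.1.1 : ZMod 3) = (q.1.1 : ZMod 3) → ∀ x,
        dist x (pt p.1) < 2 * rad p.1.1 → dist x (pt q.1) < 2 * rad q.1.1 →
        ¬ p.1.1 < q.1.1 := by
      intro p q hpq x hxp hxq hlt
      rw [ZMod.intCast_eq_intCast_iff_dvd_sub] at hpq
      have h3 : p.1.1 + 3 ≤ q.1.1 := by push_cast at hpq; omega
      have h8 : 8 * rad p.1.1 ≤ rad q.1.1 := by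
        have : (2 : ℝ) ^ (p.1.1 + 3) ≤ 2 ^ q.1.1 := zpow_le_zpow_right₀ (by norm_num) h3
        rw [zpow_add₀ (by norm_num)] at this
        simp only [hrad]
        norm_num at this ⊢
        linarith
      have e1 := hlip x (pt p.1)
      have e2 := hlip (pt q.1) x
      rw [dist_comm] at e2
      linarith [p.2.2, q.2.1, hradpos p.1.1]
    intro p q hcol x hxp hxq
    rw [Prod.mk.injEq] at hcol
    obtain ⟨hk, hz⟩ := hcol
    have hkk : p.1.1 = q.1.1 :=
      le_antisymm (not_lt.mp (hlt q p hk.symm x hxq hxp)) (not_lt.mp (hlt p q hk x hxp hxq))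
    apply Subtype.ext
    refine Prod.ext hkk ?_
    funext j
    by_contra hne'
    have hzj := congrFun hz j
    rw [ZMod.intCast_eq_intCast_iff_dvd_sub] at hzj
    have hge : ((4 * m : ℕ) : ℤ) ≤ |q.1.2 j - p.1.2 j| := by
      apply Int.le_of_dvd (abs_pos.mpr (sub_ne_zero.mpr (Ne.symm hne')))
      rwa [dvd_abs]
    have hge' : (4 * m : ℝ) ≤ |(q.1.2 j : ℝ) - p.1.2 j| := by exact_mod_cast hge
    have hc := hcoord (pt q.1) (pt p.1) j
    have heq : (pt q.1) j - (pt p.1) j = ((q.1.2 j : ℝ) - p.1.2 j) * (rad p.1.1 / m) := by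
      simp only [hpt, hkk]; ring
    have hrp := hradpos p.1.1
    rw [heq, abs_mul, abs_of_pos (div_pos hrp hm0)] at hc
    have h4 : 4 * rad p.1.1 ≤ |(q.1.2 j : ℝ) - p.1.2 j| * (rad p.1.1 / m) := by
      calc 4 * rad p.1.1 = (4 * m) * (rad p.1.1 / m) := by field_simp
        _ ≤ _ := by gcongr
    have ht := dist_triangle_left (pt q.1) (pt p.1) x
    rw [← hkk] at hxq
    linarith
  · -- covering
    intro x hx
    have hpos : 0 < infDist x E := (hcl.notMem_iff_infDist_pos hne).mp hx
    obtain ⟨k, hk1, hk2⟩ := exists_mem_Ico_zpow hpos (one_lt_two)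
    have hrk : (2 : ℝ) ^ k = 16 * rad k := by simp only [hrad]; ring
    rw [zpow_add₀ (by norm_num), zpow_one, hrk] at hk2
    rw [hrk] at hk1
    have hδ : 0 < rad k / m := div_pos (hradpos k) hm0
    set z : Fin m → ℤ := fun j => ⌊x j / (rad k / m)⌋ with hz
    have hd : dist x (pt (k, z)) ≤ rad k := by
      have := hsum x (pt (k, z)) (rad k / m) hδ.le (by
        intro j
        have h1 := Int.floor_le (x j / (rad k / m))
        have h2 := Int.lt_floor_add_one (x j / (rad k / m))
        rw [le_div_iff₀ hδ] at h1
        rw [div_lt_iff₀ hδ] at h2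
        have : (pt (k, z)) j = (⌊x j / (rad k / m)⌋ : ℝ) * (rad k / m) := rfl
        rw [this, abs_le]
        constructor <;> linarith)
      rwa [mul_div_cancel₀ _ hm0.ne'] at this
    have e1 := hlip x (pt (k, z))
    have e2 := hlip (pt (k, z)) x
    rw [dist_comm] at e2
    exact ⟨⟨(k, z), by simp only; linarith, by simp only; linarith⟩, hd⟩

/-- **Theorem 4, second part (Kovalev).** The image of `ℝ^(n)` under a bi-Lipschitz
embedding into `ℝ^m` is a Lipschitz retract of `ℝ^m`. -/
theorem image_of_symmetric_product_is_Lipschitz_retract (n m : ℕ) (hn : 1 ≤ n) (hm : 1 ≤ m)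
    (L : ℝ) (hL : 1 ≤ L)
    (f : {A : Set ℝ // A.Finite ∧ A.Nonempty ∧ A.ncard ≤ n} → EuclideanSpace ℝ (Fin m))
    (hf : ∀ A B : {A : Set ℝ // A.Finite ∧ A.Nonempty ∧ A.ncard ≤ n},
      L⁻¹ * hausdorffDist A.1 B.1 ≤ ‖f A - f B‖ ∧ ‖f A - f B‖ ≤ L * hausdorffDist A.1 B.1) :
    ∃ (C : ℝ) (r : EuclideanSpace ℝ (Fin m) → EuclideanSpace ℝ (Fin m)),
      (∀ x y : EuclideanSpace ℝ (Fin m), ‖r x - r y‖ ≤ C * ‖x - y‖) ∧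
      Set.range r ⊆ Set.range f ∧
      (∀ x ∈ Set.range f, r x = x) := by
  have hf' : ∀ A B : {A : Set ℝ // A.Finite ∧ A.Nonempty ∧ A.ncard ≤ n},
      L⁻¹ * hausdorffDist A.1 B.1 ≤ dist (f A) (f B) ∧
      dist (f A) (f B) ≤ L * hausdorffDist A.1 B.1 := by
    intro A B
    rw [dist_eq_norm]
    exact hf A B
  have hne : (Set.range f).Nonempty :=
    ⟨_, ⟨⟨{0}, Set.finite_singleton 0, Set.singleton_nonempty 0, by simpa using hn⟩, rfl⟩⟩
  obtain ⟨C, -, -, r, h1, h2, h3⟩ := sp_final m hm (Set.range f) (sp_range_closed n hn L hL f hf')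
    hne _ (by positivity) (sp_range_LC n L hL f hf')
  refine ⟨C, r, ?_, ?_, h1⟩
  · intro x y
    rw [← dist_eq_norm, ← dist_eq_norm]
    exact h3 x (Set.mem_univ x) y (Set.mem_univ y)
  · rintro _ ⟨x, rfl⟩
    exact h2 x (Set.mem_univ x)
end
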